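/- arXiv:2107.12115 — 5 statements merged into one kernel-verified Lean document; each statement's English description precedes it below -/
import Mathlib

section
/- Let α ∈ (0,1) and u ∈ B^α_{1,∞}(𝕋). Then for every nonzero g ∈ H¹(𝕋;ℂ) there exists a constant C = C(α,g) > 0, independent of u and ξ, such that ‖e^{iξu} g‖_{H^{−1/2}} ≥ C (1 + ‖u‖_{B^α_{1,∞}})^{−1/(2α)} |ξ|^{−1/(2α)} for every ξ ∈ ℝ with |ξ| ≥ 1, where e^{iξu} g denotes the function y ↦ exp(iξ u(y)) g(y). -/
open MeasureTheory Real Set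
open scoped ENNReal NNReal

noncomputable section


/-- The Besov--Nikolskii seminorm `⟦u⟧_{B^α_{1,∞}(𝕋)}` of a `2π`-periodic function,
`sup_{0<h≤π} h^{−α} ∫_{−π}^{π} |u(y+h) − u(y)| dy` (valued in `ℝ≥0∞`). -/
def besovSeminorm (α : ℝ) (u : ℝ → ℝ) : ℝ≥0∞ :=
  ⨆ h ∈ Set.Ioc (0:ℝ) π,
    ENNReal.ofReal (h ^ (-α)) * ∫⁻ y in Set.Ioc (-π) π, ENNReal.ofReal |u (y + h) - u y|

/-- The Besov--Nikolskii norm `‖u‖_{B^α_{1,∞}(𝕋)}`. -/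
def besovNorm (α : ℝ) (u : ℝ → ℝ) : ℝ≥0∞ :=
  (∫⁻ y in Set.Ioc (-π) π, ENNReal.ofReal |u y|) + besovSeminorm α u


/-- The `n`-th Fourier coefficient of a `2π`-periodic function `g : 𝕋 → ℂ`. -/
def fourierCoefT (g : ℝ → ℂ) (n : ℤ) : ℂ :=
  (1 / (2 * π) : ℂ) * ∫ y in (-π)..π, g y * Complex.exp (-(Complex.I * n * y))

/-- The Sobolev norm `‖g‖_{H^s(𝕋;ℂ)} = (Σ_n (1+n²)^s |ĝ(n)|²)^{1/2}` (valued in `ℝ≥0∞`). -/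
def sobolevNorm (s : ℝ) (g : ℝ → ℂ) : ℝ≥0∞ :=
  (∑' n : ℤ, ENNReal.ofReal ((1 + (n : ℝ) ^ 2) ^ s) * (‖fourierCoefT g n‖₊ : ℝ≥0∞) ^ 2)
    ^ (1 / 2 : ℝ)

/-- The `(k,n)`-th Fourier coefficient of a function `f : 𝕋² → ℝ`. -/
def fourierCoefT2 (f : ℝ → ℝ → ℝ) (k n : ℤ) : ℂ :=
  (1 / (2 * π) ^ 2 : ℂ) * ∫ x in (-π)..π, ∫ y in (-π)..π,
    (f x y : ℂ) * Complex.exp (-(Complex.I * ((k : ℂ) * x + (n : ℂ) * y)))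

/-- The Sobolev norm `‖f‖_{H^s(𝕋²)}` (valued in `ℝ≥0∞`). -/
def sobolevNorm2 (s : ℝ) (f : ℝ → ℝ → ℝ) : ℝ≥0∞ :=
  (∑' p : ℤ × ℤ, ENNReal.ofReal ((1 + (p.1 : ℝ) ^ 2 + (p.2 : ℝ) ^ 2) ^ s) *
    (‖fourierCoefT2 f p.1 p.2‖₊ : ℝ≥0∞) ^ 2) ^ (1 / 2 : ℝ)

/-- `u` satisfies the `(γ,ρ)`-irregularity estimate with constant `C`:
`|∫_s^t e^{iξu(z)} dz| ≤ C (t−s)^γ |ξ|^{−ρ}` for all `s < t` and `ξ ≠ 0`. -/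
def IrregOn (γ ρ : ℝ) (u : ℝ → ℝ) (C : ℝ) : Prop :=
  ∀ s t : ℝ, s < t → ∀ ξ : ℝ, ξ ≠ 0 →
    ‖∫ z in s..t, Complex.exp (Complex.I * ξ * u z)‖ ≤ C * (t - s) ^ γ * |ξ| ^ (-ρ)

/-- `‖Φ^u‖_{γ,ρ}`, the optimal constant in the `(γ,ρ)`-irregularity estimate. -/
def phiNorm (γ ρ : ℝ) (u : ℝ → ℝ) : ℝ := sInf {C : ℝ | 0 ≤ C ∧ IrregOn γ ρ u C}

/-- `u` is mixing on the scale `H^{1/2}(𝕋;ℂ)` with rate `r`. -/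
def MixingHalf (u : ℝ → ℝ) (r : ℝ → ℝ) : Prop :=
  ∃ C > (0:ℝ), ∀ k : ℤ, k ≠ 0 → ∀ t : ℝ, 1 ≤ t → ∀ g : ℝ → ℂ,
    Measurable g → Function.Periodic g (2 * π) → sobolevNorm (1/2) g < ⊤ →
    sobolevNorm (-(1/2)) (fun y => Complex.exp (-(Complex.I * t * k * u y)) * g y)
      ≤ (ENNReal.ofReal C / ENNReal.ofReal (r (t * |(k : ℝ)|))) * sobolevNorm (1/2) g
/-! ### Uniqueness of Fourier coefficients of integrable functions -/

section ContinuousTestFunctions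

open Filter Topology

variable {X : Type*} [PseudoMetricSpace X] [CompactSpace X] [MeasurableSpace X] [BorelSpace X]
  {μ : Measure X}

lemma integrable_continuousMap_smul {w : X → ℂ} (hw : Integrable w μ) (ψ : C(X, ℂ)) :
    Integrable (fun x => ψ x • w x) μ := by
  have hm : AEStronglyMeasurable ψ μ := ψ.continuous.aestronglyMeasurable
  exact hw.bdd_smul ‖ψ‖ hm (ae_of_all _ fun x => ψ.norm_coe_le_norm x)

/-- Pairing with an integrable function, as a continuous functional on continuous functions. -/
def integralPairing (w : X → ℂ) (hw : Integrable w μ) : C(X, ℂ) →L[ℂ] ℂ :=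
  LinearMap.mkContinuous
    { toFun := fun ψ => ∫ x, ψ x • w x ∂μ
      map_add' := fun ψ χ => by
        rw [← integral_add (integrable_continuousMap_smul hw ψ)
          (integrable_continuousMap_smul hw χ)]
        simp [add_mul]
      map_smul' := fun c ψ => by
        rw [RingHom.id_apply, ← integral_smul]
        simp [mul_assoc] }
    (∫ x, ‖w x‖ ∂μ) fun ψ => by
      refine (norm_integral_le_integral_norm _).trans ?_
      rw [← integral_mul_const]
      refine integral_mono (integrable_continuousMap_smul hw ψ).norm (hw.norm.mul_const _)
        fun x => ?_
      simp only [norm_smul]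
      rw [mul_comm]
      gcongr
      exact ψ.norm_coe_le_norm x

lemma integralPairing_apply {w : X → ℂ} (hw : Integrable w μ) (ψ : C(X, ℂ)) :
    integralPairing w hw ψ = ∫ x, ψ x • w x ∂μ := rfl

lemma ae_eq_zero_of_integralPairing_eq_zero {w : X → ℂ} (hw : Integrable w μ)
    (h0 : integralPairing w hw = 0) : w =ᵐ[μ] 0 := by
  refine ae_eq_zero_of_forall_setIntegral_isClosed_eq_zero hw fun s hs => ?_
  have hpos : ∀ n : ℕ, (0 : ℝ) < 1 / ((n : ℝ) + 1) := fun n => Nat.one_div_pos_of_nat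
  have hlim := thickenedIndicator_tendsto_indicator_closure hpos
    tendsto_one_div_add_atTop_nhds_zero_nat s
  rw [tendsto_pi_nhds, hs.closure_eq] at hlim
  have hcont : ∀ n : ℕ, Continuous fun x => ((thickenedIndicator (hpos n) s x : ℝ) : ℂ) := by
    intro n
    have := (thickenedIndicator (hpos n) s).continuous
    fun_prop
  have key : Tendsto (fun n : ℕ => ∫ x, ((thickenedIndicator (hpos n) s x : ℝ) : ℂ) • w x
      ∂μ) atTop (𝓝 (∫ x, s.indicator w x ∂μ)) := by
    refine tendsto_integral_of_dominated_convergence (fun x => ‖w x‖)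
      (fun n => (integrable_continuousMap_smul hw ⟨_, hcont n⟩).aestronglyMeasurable) hw.norm
      (fun n => ae_of_all _ fun x => ?_) (ae_of_all _ fun x => ?_)
    · rw [norm_smul, Complex.norm_real, NNReal.norm_eq]
      exact mul_le_of_le_one_left (norm_nonneg _) (thickenedIndicator_le_one (hpos n) s x)
    · have hx : s.indicator w x = (((s.indicator (fun _ => (1 : ℝ≥0)) x : ℝ≥0) : ℝ) : ℂ) • w x := by
        by_cases hxs : x ∈ s <;> simp [hxs]
      rw [hx]
      refine Tendsto.smul_const ?_ _
      have hc : Continuous fun r : ℝ≥0 => ((r : ℝ) : ℂ) := by fun_prop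
      exact (hc.tendsto _).comp (hlim x)
  rw [← integral_indicator hs.measurableSet]
  refine tendsto_nhds_unique key ?_
  have hzero : ∀ n : ℕ, ∫ x, ((thickenedIndicator (hpos n) s x : ℝ) : ℂ) • w x ∂μ = 0 := fun n =>
    DFunLike.congr_fun h0 (⟨_, hcont n⟩ : C(X, ℂ))
  simpa only [hzero] using tendsto_const_nhds

end ContinuousTestFunctions

section Uniqueness

variable {T : ℝ} [hT : Fact (0 < T)]

open AddCircle

lemma ae_eq_zero_of_fourierCoeff_eq_zero {w : AddCircle T → ℂ}
    (hw : Integrable w haarAddCircle) (h0 : ∀ n, fourierCoeff w n = 0) :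
    w =ᵐ[haarAddCircle] 0 := by
  refine ae_eq_zero_of_integralPairing_eq_zero hw ?_
  refine ContinuousLinearMap.ext_on
    (Submodule.dense_iff_topologicalClosure_eq_top.2 (span_fourier_closure_eq_top (T := T))) ?_
  rintro _ ⟨n, rfl⟩
  have := h0 (-n)
  rw [fourierCoeff, neg_neg] at this
  exact this

lemma integrable_continuousMap_haarAddCircle (ψ : C(AddCircle T, ℂ)) :
    Integrable ψ haarAddCircle := by
  simpa using integrable_continuousMap_smul
    (integrable_const (μ := haarAddCircle (T := T)) (1 : ℂ)) ψ

lemma fourierCoeff_continuousMap (ψ : C(AddCircle T, ℂ)) (m : ℤ) :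
    fourierCoeff ψ m = integralPairing (μ := haarAddCircle) (fourier (T := T) (-m))
      (integrable_continuousMap_haarAddCircle _) ψ := by
  rw [integralPairing_apply, fourierCoeff]
  simp only [smul_eq_mul, mul_comm]

lemma exists_continuousMap_ae_eq_of_summable_fourierCoeff {f : AddCircle T → ℂ}
    (hf : Integrable f haarAddCircle) (hs : Summable fun n => ‖fourierCoeff f n‖) :
    ∃ G : C(AddCircle T, ℂ), f =ᵐ[haarAddCircle] G := by
  have hs' : Summable fun n => fourierCoeff f n • fourier (T := T) n :=
    .of_norm (by simpa [norm_smul, fourier_norm] using hs)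
  obtain ⟨G, hG⟩ := hs'
  refine ⟨G, ?_⟩
  have hGi := integrable_continuousMap_haarAddCircle G
  have hcoef : ∀ m, fourierCoeff G m = fourierCoeff f m := by
    intro m
    rw [fourierCoeff_continuousMap]
    refine HasSum.unique (ContinuousLinearMap.hasSum _ hG) ?_
    convert hasSum_ite_eq m (fourierCoeff f m) using 2 with n
    rw [map_smul, ← fourierCoeff_continuousMap, fourierCoeff_fourier]
    by_cases h : n = m
    · subst h; simp
    · simp [h, Ne.symm h]
  have hsub := ae_eq_zero_of_fourierCoeff_eq_zero (hf.sub hGi) fun n => by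
    have := congrFun (fourierCoeff.add hf hGi.neg) n
    rw [sub_eq_add_neg, this, Pi.add_apply]
    have h2 := fourierCoeff.const_smul G (-1) n
    rw [neg_one_smul, neg_one_smul] at h2
    rw [h2, hcoef, add_neg_cancel]
  filter_upwards [hsub] with x hx
  simpa [sub_eq_zero] using hx

end Uniqueness

/-! ### Fourier coefficients of periodic functions on the line -/

lemma fourierCoefT_eq_fourierCoeffOn (F : ℝ → ℂ) (n : ℤ) :
    fourierCoefT F n = fourierCoeffOn (neg_lt_self pi_pos) F n := by
  rw [fourierCoeffOn_eq_integral, fourierCoefT, sub_neg_eq_add, ← two_mul, Complex.real_smul]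
  congr 1
  · push_cast; rfl
  · refine intervalIntegral.integral_congr fun x _ => ?_
    simp only [fourier_coe_apply, smul_eq_mul]
    rw [mul_comm]
    congr 2
    have : (π : ℂ) ≠ 0 := Complex.ofReal_ne_zero.2 pi_ne_zero
    push_cast
    field_simp

lemma fourierCoefT_congr_ae {F G : ℝ → ℂ} (h : F =ᵐ[volume.restrict (Ioc (-π) π)] G) :
    fourierCoefT F = fourierCoefT G := by
  ext n
  rw [fourierCoefT_eq_fourierCoeffOn, fourierCoefT_eq_fourierCoeffOn, fourierCoeffOn_congr_ae _ h]

lemma sobolevNorm_congr_ae (s : ℝ) {F G : ℝ → ℂ}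
    (h : F =ᵐ[volume.restrict (Ioc (-π) π)] G) : sobolevNorm s F = sobolevNorm s G := by
  rw [sobolevNorm, sobolevNorm, fourierCoefT_congr_ae h]

/-- The square of the Sobolev norm. -/
def sobolevSum (s : ℝ) (g : ℝ → ℂ) : ℝ≥0∞ :=
  ∑' n : ℤ, ENNReal.ofReal ((1 + (n : ℝ) ^ 2) ^ s) * (‖fourierCoefT g n‖₊ : ℝ≥0∞) ^ 2

lemma sobolevNorm_eq (s : ℝ) (g : ℝ → ℂ) : sobolevNorm s g = sobolevSum s g ^ (1 / 2 : ℝ) := rfl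

lemma fourierCoefT_eq_zero_of_not_integrable {g : ℝ → ℂ}
    (h : ¬ IntegrableOn g (Ioc (-π) π)) (n : ℤ) : fourierCoefT g n = 0 := by
  rw [fourierCoefT, intervalIntegral.integral_of_le (neg_lt_self pi_pos).le, integral_undef,
    mul_zero]
  refine fun hi => h ?_
  have hm : AEStronglyMeasurable (fun y : ℝ => Complex.exp (Complex.I * n * y))
      (volume.restrict (Ioc (-π) π)) :=
    Continuous.aestronglyMeasurable (by fun_prop)
  have := hi.bdd_smul 1 hm (ae_of_all _ fun y => by
    rw [Complex.norm_exp]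
    simp)
  refine this.congr (ae_of_all _ fun y => ?_)
  simp only [Pi.smul_apply', smul_eq_mul]
  rw [mul_left_comm, ← Complex.exp_add]
  simp

lemma summable_norm_fourierCoefT {g : ℝ → ℂ} (h : sobolevSum 1 g ≠ ⊤) :
    Summable fun n => ‖fourierCoefT g n‖ := by
  have h1 : Summable fun n : ℤ => (1 + (n : ℝ) ^ 2) * ‖fourierCoefT g n‖ ^ 2 := by
    have := ENNReal.summable_toReal h
    refine this.congr fun n => ?_
    have : (0 : ℝ) ≤ 1 + (n : ℝ) ^ 2 := by positivity
    simp [this]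
  have h2 : Summable fun n : ℤ => (1 + (n : ℝ) ^ 2)⁻¹ := by
    have h3 : Summable fun n : ℤ => 1 / (n : ℝ) ^ 2 := by
      simpa using Real.summable_one_div_int_pow.2 (one_lt_two)
    refine (h3.add (summable_of_hasFiniteSupport (f := fun n : ℤ => if n = 0 then (1 : ℝ) else 0)
      ?_)).of_nonneg_of_le (fun n => by positivity) fun n => ?_
    · exact (Set.finite_singleton (0 : ℤ)).subset fun n hn => by
        by_contra h
        simp_all
    · by_cases hn : n = 0
      · simp [hn]
      · have : (n : ℝ) ≠ 0 := by exact_mod_cast hn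
        simp only [hn, if_false, add_zero]
        rw [inv_eq_one_div]
        have : 0 < (n : ℝ) ^ 2 := by positivity
        gcongr
        linarith
  refine (h1.add h2).of_nonneg_of_le (fun n => norm_nonneg _) fun n => ?_
  have hp : (0 : ℝ) < 1 + (n : ℝ) ^ 2 := by positivity
  have hq : (1 + (n : ℝ) ^ 2) * (1 + (n : ℝ) ^ 2)⁻¹ = 1 := mul_inv_cancel₀ hp.ne'
  have hr : 0 < (1 + (n : ℝ) ^ 2)⁻¹ := by positivity
  set a := ‖fourierCoefT g n‖
  set p := 1 + (n : ℝ) ^ 2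
  set r := p⁻¹
  have h3 : 0 ≤ p * (a - r) ^ 2 := by positivity
  have h4 : p * (a - r) ^ 2 = p * a ^ 2 - 2 * a + r := by
    linear_combination (-2 * a + r) * hq
  have h5 : 0 ≤ a := norm_nonneg _
  linarith

lemma exists_continuous_periodic_ae_eq {g : ℝ → ℂ} (h : sobolevSum 1 g ≠ ⊤)
    (hi : IntegrableOn g (Ioc (-π) π)) :
    ∃ G : ℝ → ℂ, Continuous G ∧ Function.Periodic G (2 * π) ∧ (∃ M : ℝ, ∀ y, ‖G y‖ ≤ M) ∧
      g =ᵐ[volume.restrict (Ioc (-π) π)] G := by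
  have hT : Fact (0 < 2 * π) := ⟨two_pi_pos⟩
  have hpi : -π + 2 * π = π := by ring
  have hcoef : ∀ n, fourierCoeff (AddCircle.liftIoc (2 * π) (-π) g) n = fourierCoefT g n := by
    intro n
    rw [fourierCoeff_liftIoc_eq, fourierCoefT_eq_fourierCoeffOn]
    congr 1
  have hint : Integrable (AddCircle.liftIoc (2 * π) (-π) g) AddCircle.haarAddCircle := by
    rw [← memLp_one_iff_integrable]
    refine MemLp.haarAddCircle (MemLp.memLp_liftIoc ?_)
    rw [memLp_one_iff_integrable, hpi]
    exact hi
  obtain ⟨G, hG⟩ := exists_continuousMap_ae_eq_of_summable_fourierCoeff hint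
    (by simpa only [hcoef] using summable_norm_fourierCoefT h)
  refine ⟨fun y => G (y : AddCircle (2 * π)), G.continuous.comp (AddCircle.continuous_mk' _),
    fun y => by simp, ⟨‖G‖, fun y => G.norm_coe_le_norm _⟩, ?_⟩
  have hG' : AddCircle.liftIoc (2 * π) (-π) g =ᵐ[volume] G := by
    rw [AddCircle.volume_eq_smul_haarAddCircle]
    exact Measure.ae_smul_measure hG _
  have hmp := AddCircle.measurePreserving_mk (2 * π) (-π)
  rw [hpi] at hmp
  have h1 := hmp.quasiMeasurePreserving.ae_eq_comp hG'
  filter_upwards [h1, ae_restrict_mem measurableSet_Ioc] with y hy hmem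
  rw [Function.comp_apply, Function.comp_apply, AddCircle.liftIoc_coe_apply] at hy
  · exact hy
  · rwa [hpi]

lemma tsum_sq_fourierCoefT {F : ℝ → ℂ} (hF : MemLp F 2 (volume.restrict (Ioc (-π) π))) :
    ∑' n : ℤ, (‖fourierCoefT F n‖₊ : ℝ≥0∞) ^ 2 =
      ENNReal.ofReal (2 * π)⁻¹ * ∫⁻ y in Ioc (-π) π, ENNReal.ofReal (‖F y‖ ^ 2) := by
  have h := hasSum_sq_fourierCoeffOn (neg_lt_self pi_pos) hF
  have h2 := ENNReal.ofReal_tsum_of_nonneg (fun n => by positivity) h.summable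
  rw [h.tsum_eq, smul_eq_mul, ENNReal.ofReal_mul (by have := pi_pos; simp; positivity),
    intervalIntegral.integral_of_le (neg_lt_self pi_pos).le,
    ofReal_integral_eq_lintegral_ofReal ((memLp_two_iff_integrable_sq_norm hF.1).1 hF)
      (ae_of_all _ fun y => by positivity),
    sub_neg_eq_add, ← two_mul] at h2
  rw [h2]
  refine tsum_congr fun n => ?_
  rw [fourierCoefT_eq_fourierCoeffOn, ENNReal.ofReal_pow (norm_nonneg _), ofReal_norm, enorm_eq_nnnorm]

lemma fourierCoefT_comp_add {F : ℝ → ℂ} (hF : Function.Periodic F (2 * π)) (h : ℝ) (n : ℤ) :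
    fourierCoefT (fun y => F (y + h)) n = Complex.exp (Complex.I * n * h) * fourierCoefT F n := by
  rw [fourierCoefT, fourierCoefT, mul_left_comm]
  congr 1
  have hper : Function.Periodic (fun y : ℝ => F y * Complex.exp (-(Complex.I * n * y)))
      (2 * π) := by
    intro y
    simp only [hF y]
    congr 1
    rw [Complex.exp_eq_exp_iff_exists_int]
    refine ⟨-n, ?_⟩
    push_cast
    ring
  have h1 := hper.intervalIntegral_add_eq (-π + h) (-π)
  rw [show -π + h + 2 * π = π + h by ring, show -π + 2 * π = π by ring] at h1
  rw [← h1, ← intervalIntegral.integral_comp_add_right, ← intervalIntegral.integral_const_mul]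
  refine intervalIntegral.integral_congr fun y _ => ?_
  rw [mul_left_comm, ← Complex.exp_add]
  congr 2
  push_cast
  ring

lemma fourierCoefT_sub {F G : ℝ → ℂ} (hF : IntegrableOn F (Ioc (-π) π))
    (hG : IntegrableOn G (Ioc (-π) π)) (n : ℤ) :
    fourierCoefT (fun y => F y - G y) n = fourierCoefT F n - fourierCoefT G n := by
  have hmul : ∀ {F : ℝ → ℂ}, IntegrableOn F (Ioc (-π) π) → IntervalIntegrable
      (fun y : ℝ => F y * Complex.exp (-(Complex.I * n * y))) volume (-π) π := by
    intro F hF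
    rw [← intervalIntegrable_iff_integrableOn_Ioc_of_le (neg_lt_self pi_pos).le] at hF
    exact hF.mul_continuousOn (Continuous.continuousOn (by fun_prop))
  simp only [fourierCoefT, sub_mul]
  rw [intervalIntegral.integral_sub (hmul hF) (hmul hG), mul_sub]

lemma norm_sq_exp_sub_one (x : ℝ) : ‖Complex.exp (Complex.I * x) - 1‖ ^ 2 = 2 - 2 * cos x := by
  rw [← Complex.normSq_eq_norm_sq, mul_comm, Complex.exp_mul_I, ← Complex.ofReal_cos,
    ← Complex.ofReal_sin, Complex.normSq_apply]
  simp [-Complex.ofReal_cos, -Complex.ofReal_sin]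
  nlinarith [sin_sq_add_cos_sq x]

lemma memLp_two_of_bounded {F : ℝ → ℂ} (hm : Measurable F) {M : ℝ} (hM : ∀ y, ‖F y‖ ≤ M) :
    MemLp F 2 (volume.restrict (Ioc (-π) π)) :=
  MemLp.of_bound hm.aestronglyMeasurable M (ae_of_all _ hM)

lemma tsum_translation_sub {F : ℝ → ℂ} (hm : Measurable F) {M : ℝ} (hM : ∀ y, ‖F y‖ ≤ M)
    (hF : Function.Periodic F (2 * π)) (h : ℝ) :
    ∑' n : ℤ, ENNReal.ofReal (2 - 2 * cos (n * h)) * (‖fourierCoefT F n‖₊ : ℝ≥0∞) ^ 2 =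
      ENNReal.ofReal (2 * π)⁻¹ *
        ∫⁻ y in Ioc (-π) π, ENNReal.ofReal (‖F (y + h) - F y‖ ^ 2) := by
  have hm' : Measurable fun y => F (y + h) := hm.comp (measurable_add_const h)
  have h1 := memLp_two_of_bounded hm' fun y => hM (y + h)
  have h2 := memLp_two_of_bounded hm hM
  refine Eq.trans ?_ (tsum_sq_fourierCoefT (h1.sub h2))
  refine tsum_congr fun n => ?_
  have h3 := fourierCoefT_sub (h1.integrable one_le_two) (h2.integrable one_le_two) n
  have h4 : fourierCoefT (fun y => F (y + h) - F y) n =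
      (Complex.exp (Complex.I * (n * h : ℝ)) - 1) * fourierCoefT F n := by
    refine h3.trans ?_
    rw [fourierCoefT_comp_add hF]
    push_cast
    ring_nf
  rw [h4, nnnorm_mul, ENNReal.coe_mul, mul_pow, ← norm_sq_exp_sub_one,
    ENNReal.ofReal_pow (norm_nonneg _), ofReal_norm, enorm_eq_nnnorm]

/-! ### Modulated functions -/

lemma norm_sq_exp_sub_exp_le (a b : ℝ) :
    ‖Complex.exp (Complex.I * a) - Complex.exp (Complex.I * b)‖ ^ 2 ≤ 2 * |a - b| := by
  have h1 : ∀ x : ℝ, ‖Complex.exp (Complex.I * x)‖ = 1 := fun x => by simp [Complex.norm_exp]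
  have h2 : ‖Complex.exp (Complex.I * a) - Complex.exp (Complex.I * b)‖ ≤ 2 := by
    refine (norm_sub_le _ _).trans ?_
    rw [h1, h1]
    norm_num
  have h3 : ‖Complex.exp (Complex.I * a) - Complex.exp (Complex.I * b)‖ ≤ |a - b| := by
    have : Complex.exp (Complex.I * a) - Complex.exp (Complex.I * b) =
        Complex.exp (Complex.I * b) * (Complex.exp (Complex.I * (a - b : ℝ)) - 1) := by
      rw [mul_sub, ← Complex.exp_add]
      push_cast
      ring_nf
    rw [this, norm_mul, h1, one_mul]
    exact Real.norm_exp_I_mul_ofReal_sub_one_le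
  rw [sq]
  exact mul_le_mul h2 h3 (norm_nonneg _) zero_le_two

/-- The function `y ↦ e^{iξu(y)} g(y)`. -/
def modulate (ξ : ℝ) (u : ℝ → ℝ) (g : ℝ → ℂ) (y : ℝ) : ℂ :=
  Complex.exp (Complex.I * ξ * u y) * g y

lemma norm_modulate (ξ : ℝ) (u : ℝ → ℝ) (g : ℝ → ℂ) (y : ℝ) : ‖modulate ξ u g y‖ = ‖g y‖ := by
  simp [modulate, Complex.norm_exp]

lemma norm_sq_modulate_sub_le (ξ : ℝ) (u : ℝ → ℝ) {g : ℝ → ℂ} {M : ℝ} (hM : ∀ y, ‖g y‖ ≤ M)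
    (y z : ℝ) : ‖modulate ξ u g z - modulate ξ u g y‖ ^ 2 ≤
      2 * ‖g z - g y‖ ^ 2 + 4 * M ^ 2 * |ξ| * |u z - u y| := by
  have h1 : modulate ξ u g z - modulate ξ u g y =
      Complex.exp (Complex.I * (ξ * u z : ℝ)) * (g z - g y) +
      (Complex.exp (Complex.I * (ξ * u z : ℝ)) - Complex.exp (Complex.I * (ξ * u y : ℝ))) * g y := by
    simp only [modulate]
    push_cast
    ring_nf
  have h2 : ‖Complex.exp (Complex.I * (ξ * u z : ℝ)) * (g z - g y)‖ = ‖g z - g y‖ := by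
    rw [norm_mul, Complex.norm_exp]
    simp
  have h3 := norm_sq_exp_sub_exp_le (ξ * u z) (ξ * u y)
  rw [← mul_sub, abs_mul] at h3
  set E := Complex.exp (Complex.I * (ξ * u z : ℝ)) - Complex.exp (Complex.I * (ξ * u y : ℝ))
  have h4 : ‖E * g y‖ ^ 2 ≤ 2 * (|ξ| * |u z - u y|) * M ^ 2 := by
    rw [norm_mul, mul_pow]
    gcongr
    exact hM y
  have h5 := norm_add_le (Complex.exp (Complex.I * (ξ * u z : ℝ)) * (g z - g y)) (E * g y)
  rw [← h1, h2] at h5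
  have h6 : ‖modulate ξ u g z - modulate ξ u g y‖ ^ 2 ≤ (‖g z - g y‖ + ‖E * g y‖) ^ 2 := by
    gcongr
  nlinarith [sq_nonneg (‖g z - g y‖ - ‖E * g y‖)]

lemma tsum_translation_sub_le {g : ℝ → ℂ} (hm : Measurable g) {M : ℝ} (hM : ∀ y, ‖g y‖ ≤ M)
    (hg : Function.Periodic g (2 * π)) (h : ℝ) :
    ENNReal.ofReal (2 * π)⁻¹ * ∫⁻ y in Ioc (-π) π, ENNReal.ofReal (‖g (y + h) - g y‖ ^ 2) ≤
      ENNReal.ofReal (h ^ 2) * sobolevSum 1 g := by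
  rw [← tsum_translation_sub hm hM hg, sobolevSum, ← ENNReal.tsum_mul_left]
  refine ENNReal.tsum_le_tsum fun n => ?_
  rw [← mul_assoc, ← ENNReal.ofReal_mul (by positivity), rpow_one]
  gcongr
  have := one_sub_sq_div_two_le_cos (x := n * h)
  nlinarith [sq_nonneg h]

lemma lintegral_translation_le_besovNorm (α : ℝ) (u : ℝ → ℝ) {h : ℝ} (hh : h ∈ Ioc 0 π) :
    ∫⁻ y in Ioc (-π) π, ENNReal.ofReal |u (y + h) - u y| ≤
      ENNReal.ofReal (h ^ α) * besovNorm α u := by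
  have h1 : ENNReal.ofReal (h ^ (-α)) *
      ∫⁻ y in Ioc (-π) π, ENNReal.ofReal |u (y + h) - u y| ≤ besovNorm α u :=
    (le_iSup₂ (f := fun h (_ : h ∈ Ioc 0 π) => ENNReal.ofReal (h ^ (-α)) *
      ∫⁻ y in Ioc (-π) π, ENNReal.ofReal |u (y + h) - u y|) h hh).trans le_add_self
  calc _ = ENNReal.ofReal (h ^ α) * (ENNReal.ofReal (h ^ (-α)) *
      ∫⁻ y in Ioc (-π) π, ENNReal.ofReal |u (y + h) - u y|) := by
        rw [← mul_assoc, ← ENNReal.ofReal_mul (rpow_nonneg hh.1.le _), ← rpow_add hh.1]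
        simp
    _ ≤ _ := by gcongr

lemma measurable_modulate {ξ : ℝ} {u : ℝ → ℝ} {g : ℝ → ℂ} (hu : Measurable u)
    (hg : Measurable g) : Measurable (modulate ξ u g) := by
  unfold modulate
  fun_prop

lemma periodic_modulate {ξ T : ℝ} {u : ℝ → ℝ} {g : ℝ → ℂ} (hu : Function.Periodic u T)
    (hg : Function.Periodic g T) : Function.Periodic (modulate ξ u g) T := fun y => by
  simp only [modulate, hu y, hg y]

lemma tsum_modulate_le {α : ℝ} (hα : α ∈ Ioo (0 : ℝ) 1) {g : ℝ → ℂ} (hm : Measurable g) {M : ℝ}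
    (hM : ∀ y, ‖g y‖ ≤ M) (hg : Function.Periodic g (2 * π)) (hS : sobolevSum 1 g ≠ ⊤)
    {u : ℝ → ℝ} (hu : Measurable u) (hup : Function.Periodic u (2 * π)) (hB : besovNorm α u ≠ ⊤)
    {ξ : ℝ} (hξ : 1 ≤ |ξ|) {h : ℝ} (hh : h ∈ Ioc (0 : ℝ) 1) :
    ∑' n : ℤ, ENNReal.ofReal (2 - 2 * cos (n * h)) *
        (‖fourierCoefT (modulate ξ u g) n‖₊ : ℝ≥0∞) ^ 2 ≤
      ENNReal.ofReal ((2 * (sobolevSum 1 g).toReal + M ^ 2) *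
        (|ξ| * (1 + (besovNorm α u).toReal)) * h ^ α) := by
  have hM' : ∀ y, ‖modulate ξ u g y‖ ≤ M := fun y => by rw [norm_modulate]; exact hM y
  rw [tsum_translation_sub (measurable_modulate hu hm) hM' (periodic_modulate hup hg)]
  have hmd : Measurable fun y => ENNReal.ofReal |u (y + h) - u y| := by fun_prop
  have hmg : Measurable fun y => ENNReal.ofReal (‖g (y + h) - g y‖ ^ 2) := by fun_prop
  have hhπ : h ∈ Ioc 0 π := ⟨hh.1, hh.2.trans (by linarith [pi_gt_three])⟩
  calc _ ≤ ENNReal.ofReal (2 * π)⁻¹ * ∫⁻ y in Ioc (-π) π,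
        (ENNReal.ofReal 2 * ENNReal.ofReal (‖g (y + h) - g y‖ ^ 2) +
          ENNReal.ofReal (4 * M ^ 2 * |ξ|) * ENNReal.ofReal |u (y + h) - u y|) := by
        gcongr with y
        rw [← ENNReal.ofReal_mul (by positivity), ← ENNReal.ofReal_mul (by positivity),
          ← ENNReal.ofReal_add (by positivity) (by positivity)]
        exact ENNReal.ofReal_le_ofReal (norm_sq_modulate_sub_le ξ u hM y (y + h))
    _ = ENNReal.ofReal 2 * (ENNReal.ofReal (2 * π)⁻¹ *
          ∫⁻ y in Ioc (-π) π, ENNReal.ofReal (‖g (y + h) - g y‖ ^ 2)) +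
        ENNReal.ofReal (2 * π)⁻¹ * (ENNReal.ofReal (4 * M ^ 2 * |ξ|) *
          ∫⁻ y in Ioc (-π) π, ENNReal.ofReal |u (y + h) - u y|) := by
        rw [lintegral_add_left (hmg.const_mul _), lintegral_const_mul _ hmg,
          lintegral_const_mul _ hmd]
        ring
    _ ≤ ENNReal.ofReal 2 * (ENNReal.ofReal (h ^ 2) * sobolevSum 1 g) +
        ENNReal.ofReal (2 * π)⁻¹ * (ENNReal.ofReal (4 * M ^ 2 * |ξ|) *
          (ENNReal.ofReal (h ^ α) * besovNorm α u)) := by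
        exact add_le_add (mul_le_mul' le_rfl (tsum_translation_sub_le hm hM hg h))
          (mul_le_mul' le_rfl (mul_le_mul' le_rfl
            (lintegral_translation_le_besovNorm α u hhπ)))
    _ = ENNReal.ofReal (2 * (h ^ 2 * (sobolevSum 1 g).toReal) +
        (2 * π)⁻¹ * (4 * M ^ 2 * |ξ| * (h ^ α * (besovNorm α u).toReal))) := by
        have := rpow_nonneg hh.1.le α
        have := pi_pos
        rw [ENNReal.ofReal_add (by positivity) (by positivity),
          ENNReal.ofReal_mul (p := 2) (by positivity),
          ENNReal.ofReal_mul (p := h ^ 2) (by positivity),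
          ENNReal.ofReal_mul (p := (2 * π)⁻¹) (by positivity),
          ENNReal.ofReal_mul (p := 4 * M ^ 2 * |ξ|) (by positivity),
          ENNReal.ofReal_mul (p := h ^ α) (by positivity), ENNReal.ofReal_toReal hS,
          ENNReal.ofReal_toReal hB]
    _ ≤ _ := by
        refine ENNReal.ofReal_le_ofReal ?_
        have hhα := rpow_nonneg hh.1.le α
        have h1 : h ^ 2 ≤ h ^ α := by
          rw [← rpow_two]
          exact rpow_le_rpow_of_exponent_ge hh.1 hh.2 (by linarith [hα.2])
        have h2 : (2 * π)⁻¹ * 4 ≤ 1 := by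
          rw [inv_mul_le_iff₀ (by linarith [pi_pos])]
          linarith [pi_gt_three]
        set S := (sobolevSum 1 g).toReal
        set B := (besovNorm α u).toReal
        have hS0 : 0 ≤ S := ENNReal.toReal_nonneg
        have hB0 : 0 ≤ B := ENNReal.toReal_nonneg
        have h3 : 1 ≤ |ξ| * (1 + B) := by nlinarith
        calc _ = 2 * (h ^ 2 * S) + ((2 * π)⁻¹ * 4) * (M ^ 2 * (|ξ| * B) * h ^ α) := by ring
          _ ≤ 2 * (h ^ α * S) * (|ξ| * (1 + B)) + 1 * (M ^ 2 * (|ξ| * (1 + B)) * h ^ α) := by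
            refine add_le_add ?_ (mul_le_mul h2 ?_ (by positivity) zero_le_one)
            · refine le_trans ?_ (le_mul_of_one_le_right (by positivity) h3)
              gcongr
            · gcongr
              linarith
          _ = _ := by ring

/-! ### Averaging over translations -/

lemma lintegral_two_sub_two_cos {H : ℝ} (hH : 0 < H) (hH1 : H ≤ 1) (n : ℤ) :
    ENNReal.ofReal H ≤ ENNReal.ofReal 3 * ENNReal.ofReal ((1 + (n : ℝ) ^ 2) ^ (-(1 / 2) : ℝ)) +
      ∫⁻ h in Ioc 0 H, ENNReal.ofReal (2 - 2 * cos (n * h)) := by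
  have hpos : (0 : ℝ) < 1 + (n : ℝ) ^ 2 := by positivity
  have hsqrt : (1 + (n : ℝ) ^ 2) ^ (-(1 / 2) : ℝ) = (√(1 + (n : ℝ) ^ 2))⁻¹ := by
    rw [rpow_neg hpos.le, ← sqrt_eq_rpow]
  by_cases hn : 2 ≤ |(n : ℝ)| * H
  · refine le_add_left ?_
    have hn0 : (n : ℝ) ≠ 0 := by
      rintro h0
      rw [h0] at hn
      norm_num at hn
    rw [← ofReal_integral_eq_lintegral_ofReal]
    · refine ENNReal.ofReal_le_ofReal ?_
      rw [← intervalIntegral.integral_of_le hH.le, intervalIntegral.integral_sub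
        (Continuous.intervalIntegrable (by fun_prop) _ _)
        (Continuous.intervalIntegrable (by fun_prop) _ _), intervalIntegral.integral_const,
        intervalIntegral.integral_const_mul, intervalIntegral.integral_comp_mul_left _ hn0,
        integral_cos]
      simp only [mul_zero, sin_zero, sub_zero, smul_eq_mul]
      have h1 : (n : ℝ)⁻¹ * sin (n * H) ≤ H / 2 := by
        refine (le_abs_self _).trans ?_
        rw [abs_mul, abs_inv, inv_mul_le_iff₀ (abs_pos.2 hn0)]
        have := abs_sin_le_one (n * H)
        linarith
      linarith
    · exact (Continuous.integrableOn_Icc (by fun_prop)).mono_set Ioc_subset_Icc_self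
    · exact ae_of_all _ fun h => by
        have := cos_le_one (n * h)
        simp only [Pi.zero_apply]
        linarith
  · refine le_add_right ?_
    rw [← ENNReal.ofReal_mul zero_le_three, hsqrt]
    refine ENNReal.ofReal_le_ofReal ?_
    rw [← div_eq_mul_inv, le_div_iff₀ (sqrt_pos.2 hpos)]
    nth_rw 1 [← abs_of_pos hH, ← sqrt_sq_eq_abs]
    rw [← sqrt_mul (sq_nonneg H)]
    refine sqrt_le_iff.2 ⟨zero_le_three, ?_⟩
    rw [← sq_abs (n : ℝ)]
    have h1 : 0 ≤ |(n : ℝ)| * H := by positivity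
    nlinarith

lemma mul_tsum_sq_fourierCoefT_le {F : ℝ → ℂ} {H : ℝ} (hH : 0 < H) (hH1 : H ≤ 1) {b : ℝ≥0∞}
    (hb : ∀ h ∈ Ioc 0 H, ∑' n : ℤ, ENNReal.ofReal (2 - 2 * cos (n * h)) *
      (‖fourierCoefT F n‖₊ : ℝ≥0∞) ^ 2 ≤ b) :
    ENNReal.ofReal H * ∑' n : ℤ, (‖fourierCoefT F n‖₊ : ℝ≥0∞) ^ 2 ≤
      ENNReal.ofReal 3 * sobolevSum (-(1 / 2)) F + b * ENNReal.ofReal H := by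
  have hmeas : ∀ n : ℤ, Measurable fun h : ℝ => ENNReal.ofReal (2 - 2 * cos (n * h)) :=
    fun n => by fun_prop
  have h1 : ∑' n : ℤ, (∫⁻ h in Ioc 0 H, ENNReal.ofReal (2 - 2 * cos (n * h))) *
      (‖fourierCoefT F n‖₊ : ℝ≥0∞) ^ 2 ≤ b * ENNReal.ofReal H := by
    calc _ = ∫⁻ h in Ioc 0 H, ∑' n : ℤ, ENNReal.ofReal (2 - 2 * cos (n * h)) *
          (‖fourierCoefT F n‖₊ : ℝ≥0∞) ^ 2 := by
          rw [lintegral_tsum fun n => ((hmeas n).mul_const _).aemeasurable]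
          exact tsum_congr fun n => (lintegral_mul_const _ (hmeas n)).symm
      _ ≤ ∫⁻ _ in Ioc 0 H, b := setLIntegral_mono measurable_const hb
      _ = b * ENNReal.ofReal H := by simp
  refine le_trans ?_ (add_le_add le_rfl h1)
  rw [sobolevSum, ← ENNReal.tsum_mul_left, ← ENNReal.tsum_mul_left, ← ENNReal.tsum_add]
  refine ENNReal.tsum_le_tsum fun n => ?_
  rw [← mul_assoc, ← add_mul]
  exact mul_le_mul' (lintegral_two_sub_two_cos hH hH1 n) le_rfl

lemma tsum_sq_fourierCoefT_modulate {g : ℝ → ℂ} (hm : Measurable g) {M : ℝ}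
    (hM : ∀ y, ‖g y‖ ≤ M) {u : ℝ → ℝ} (hu : Measurable u) (ξ : ℝ) :
    ∑' n : ℤ, (‖fourierCoefT (modulate ξ u g) n‖₊ : ℝ≥0∞) ^ 2 =
      ∑' n : ℤ, (‖fourierCoefT g n‖₊ : ℝ≥0∞) ^ 2 := by
  have hM' : ∀ y, ‖modulate ξ u g y‖ ≤ M := fun y => by rw [norm_modulate]; exact hM y
  rw [tsum_sq_fourierCoefT (memLp_two_of_bounded hm hM),
    tsum_sq_fourierCoefT (memLp_two_of_bounded (measurable_modulate hu hm) hM')]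
  simp only [norm_modulate]

lemma tsum_sq_fourierCoefT_le_sobolevSum_one (g : ℝ → ℂ) :
    ∑' n : ℤ, (‖fourierCoefT g n‖₊ : ℝ≥0∞) ^ 2 ≤ sobolevSum 1 g := by
  refine ENNReal.tsum_le_tsum fun n => le_mul_of_one_le_left' ?_
  rw [rpow_one, ENNReal.one_le_ofReal]
  nlinarith [sq_nonneg (n : ℝ)]

lemma sobolevSum_modulate_ge {α : ℝ} (hα : α ∈ Ioo (0 : ℝ) 1) {g : ℝ → ℂ} (hm : Measurable g)
    {M : ℝ} (hM : ∀ y, ‖g y‖ ≤ M) (hg : Function.Periodic g (2 * π)) (hS : sobolevSum 1 g ≠ ⊤)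
    {u : ℝ → ℝ} (hu : Measurable u) (hup : Function.Periodic u (2 * π)) (hB : besovNorm α u ≠ ⊤)
    {ξ : ℝ} (hξ : 1 ≤ |ξ|) {E : ℝ} (hE : 0 < E)
    (hgE : ∑' n : ℤ, (‖fourierCoefT g n‖₊ : ℝ≥0∞) ^ 2 = ENNReal.ofReal E)
    {H : ℝ} (hH : 0 < H) (hH1 : H ≤ 1)
    (hHE : (2 * (sobolevSum 1 g).toReal + M ^ 2) * (|ξ| * (1 + (besovNorm α u).toReal)) * H ^ α ≤
      E / 2) :
    ENNReal.ofReal (H * E / 6) ≤ sobolevSum (-(1 / 2)) (modulate ξ u g) := by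
  have key := mul_tsum_sq_fourierCoefT_le (F := modulate ξ u g) hH hH1
    (b := ENNReal.ofReal (E / 2)) fun h hh => by
      refine (tsum_modulate_le hα hm hM hg hS hu hup hB hξ ⟨hh.1, hh.2.trans hH1⟩).trans
        (ENNReal.ofReal_le_ofReal (le_trans ?_ hHE))
      have h1 : h ^ α ≤ H ^ α := rpow_le_rpow hh.1.le hh.2 hα.1.le
      have h2 : 0 ≤ (sobolevSum 1 g).toReal := ENNReal.toReal_nonneg
      have h3 : 0 ≤ (besovNorm α u).toReal := ENNReal.toReal_nonneg
      gcongr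
  rw [tsum_sq_fourierCoefT_modulate hm hM hu, hgE] at key
  by_cases htop : sobolevSum (-(1 / 2)) (modulate ξ u g) = ⊤
  · rw [htop]
    exact le_top
  rw [← ENNReal.ofReal_toReal htop] at key ⊢
  have h0 : 0 ≤ (sobolevSum (-(1 / 2)) (modulate ξ u g)).toReal := ENNReal.toReal_nonneg
  rw [← ENNReal.ofReal_mul hH.le, ← ENNReal.ofReal_mul zero_le_three,
    ← ENNReal.ofReal_mul (by positivity), ← ENNReal.ofReal_add (by positivity) (by positivity),
    ENNReal.ofReal_le_ofReal_iff (by positivity)] at key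
  exact ENNReal.ofReal_le_ofReal (by linarith)

lemma inviscid_lower_bound_of_continuous {α : ℝ} (hα : α ∈ Ioo (0 : ℝ) 1) {g : ℝ → ℂ}
    (hm : Measurable g) {M : ℝ} (hM : ∀ y, ‖g y‖ ≤ M) (hg : Function.Periodic g (2 * π))
    (hS : sobolevSum 1 g ≠ ⊤) (hS0 : sobolevSum 1 g ≠ 0) :
    ∃ C > (0 : ℝ), ∀ u : ℝ → ℝ,
      Measurable u → Function.Periodic u (2 * π) → besovNorm α u < ⊤ →
      ∀ ξ : ℝ, 1 ≤ |ξ| →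
        ENNReal.ofReal C * (1 + besovNorm α u) ^ (-(1 / (2 * α))) *
            ENNReal.ofReal (|ξ| ^ (-(1 / (2 * α))))
          ≤ sobolevNorm (-(1 / 2)) (modulate ξ u g) := by
  set e := ∑' n : ℤ, (‖fourierCoefT g n‖₊ : ℝ≥0∞) ^ 2 with he
  have he_top : e ≠ ⊤ := ne_top_of_le_ne_top hS (tsum_sq_fourierCoefT_le_sobolevSum_one g)
  have he_zero : e ≠ 0 := by
    intro h
    refine hS0 ?_
    rw [he, ENNReal.tsum_eq_zero] at h
    simp only [sobolevSum, h, mul_zero, tsum_zero]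
  set E := e.toReal
  have hE : 0 < E := ENNReal.toReal_pos he_zero he_top
  set K := 2 * (sobolevSum 1 g).toReal + M ^ 2 with hK
  have hK0 : 0 ≤ K := by
    have : 0 ≤ (sobolevSum 1 g).toReal := ENNReal.toReal_nonneg
    positivity
  have hα0 := hα.1
  set D := E / (2 * (K + E)) with hD
  have hD0 : 0 < D := by positivity
  refine ⟨D ^ (1 / (2 * α)) * (E / 6) ^ (1 / 2 : ℝ), by positivity, ?_⟩
  intro u hu hup hB ξ hξ
  set B := (besovNorm α u).toReal with hBdef
  have hB0 : 0 ≤ B := ENNReal.toReal_nonneg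
  set X := |ξ| * (1 + B) with hX
  have hX1 : 1 ≤ X := by nlinarith
  have hX0 : 0 < X := by linarith
  have hξ0 : 0 < |ξ| := by linarith
  have hHα : ((D / X) ^ (1 / α)) ^ α = D / X := by
    rw [← rpow_mul (by positivity), one_div_mul_cancel hα0.ne', rpow_one]
  have hD1 : D ≤ 1 := by
    rw [hD, div_le_one (by positivity)]
    linarith
  have key := sobolevSum_modulate_ge hα hm hM hg hS hu hup hB.ne hξ hE
    (ENNReal.ofReal_toReal he_top).symm (H := (D / X) ^ (1 / α)) (by positivity)
    (rpow_le_one (by positivity) ((div_le_one hX0).2 (hD1.trans hX1)) (by positivity)) (by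
      rw [hHα, ← hK, mul_assoc, mul_div_cancel₀ _ hX0.ne', hD, ← mul_div_assoc,
        div_le_div_iff₀ (by positivity) two_pos]
      nlinarith)
  rw [sobolevNorm_eq]
  refine le_trans (le_of_eq ?_) (ENNReal.rpow_le_rpow key (by norm_num))
  have h1 : 1 + besovNorm α u = ENNReal.ofReal (1 + B) := by
    rw [ENNReal.ofReal_add zero_le_one hB0, ENNReal.ofReal_one, ENNReal.ofReal_toReal hB.ne]
  rw [h1, ENNReal.ofReal_rpow_of_pos (by positivity), ENNReal.ofReal_rpow_of_pos (by positivity),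
    ← ENNReal.ofReal_mul (by positivity), ← ENNReal.ofReal_mul (by positivity)]
  congr 1
  rw [mul_div_assoc, mul_rpow (by positivity) (by positivity), ← rpow_mul (by positivity),
    show 1 / α * (1 / 2) = 1 / (2 * α) by field_simp, div_rpow hD0.le hX0.le, hX,
    mul_rpow hξ0.le (by positivity), rpow_neg hξ0.le, rpow_neg (by positivity)]
  field_simp

/-- lower bound on mixing, Lemma 3.1: for `α ∈ (0,1)`,
`u ∈ B^α_{1,∞}(𝕋)` and nonzero `g ∈ H¹(𝕋;ℂ)`, there is `C = C(α,g) > 0` such that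
`‖e^{iξu} g‖_{H^{−1/2}} ≥ C (1+‖u‖_{B^α_{1,∞}})^{−1/(2α)} |ξ|^{−1/(2α)}` for `|ξ| ≥ 1`. -/
theorem inviscid_lower_bound
    (α : ℝ) (hα : α ∈ Set.Ioo (0:ℝ) 1)
    (g : ℝ → ℂ) (hg_meas : Measurable g) (hg_per : Function.Periodic g (2 * π))
    (hg_H1 : sobolevNorm 1 g < ⊤) (hg_ne : sobolevNorm 1 g ≠ 0) :
    ∃ C > (0:ℝ), ∀ u : ℝ → ℝ,
      Measurable u → Function.Periodic u (2 * π) → besovNorm α u < ⊤ →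
      ∀ ξ : ℝ, 1 ≤ |ξ| →
        ENNReal.ofReal C * (1 + besovNorm α u) ^ (-(1 / (2 * α))) *
            ENNReal.ofReal (|ξ| ^ (-(1 / (2 * α))))
          ≤ sobolevNorm (-(1/2)) fun y => Complex.exp (Complex.I * ξ * u y) * g y := by
  have hS : sobolevSum 1 g ≠ ⊤ := by
    intro h
    rw [sobolevNorm_eq, h, ENNReal.top_rpow_of_pos (by norm_num)] at hg_H1
    exact lt_irrefl _ hg_H1
  have hS0 : sobolevSum 1 g ≠ 0 := by
    intro h
    rw [sobolevNorm_eq, h, ENNReal.zero_rpow_of_pos (by norm_num)] at hg_ne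
    exact hg_ne rfl
  have hi : IntegrableOn g (Ioc (-π) π) := by
    by_contra h
    refine hS0 ?_
    simp [sobolevSum, fourierCoefT_eq_zero_of_not_integrable h]
  obtain ⟨G, hGc, hGp, ⟨M, hM⟩, hae⟩ := exists_continuous_periodic_ae_eq hS hi
  have hsum : sobolevSum 1 G = sobolevSum 1 g := by
    rw [sobolevSum, sobolevSum, fourierCoefT_congr_ae hae]
  obtain ⟨C, hC, h⟩ := inviscid_lower_bound_of_continuous hα hGc.measurable hM hGp
    (hsum ▸ hS) (hsum ▸ hS0)
  refine ⟨C, hC, fun u hu hup hB ξ hξ => (h u hu hup hB ξ hξ).trans (le_of_eq ?_)⟩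
  refine sobolevNorm_congr_ae _ ?_
  filter_upwards [hae] with y hy
  rw [modulate, hy]
end
end

section
/- Let α > 0 and let u : 𝕋 → ℝ be an integrable function (a fixed Borel representative) satisfying Γ_α(u) > 0. Then for every ȳ ∈ 𝕋 and every δ ∈ (0,1) one has sup_{z : d_𝕋(z,ȳ) ≤ δ} |u(z) − u(ȳ)| ≥ Γ_α(u) δ^α; in particular u is α-Hölder rough with modulus of roughness L_α(u) := inf_{ȳ ∈ 𝕋, δ ∈ (0,1)} δ^{−α} sup_{z : d_𝕋(z,ȳ) ≤ δ} |u(z) − u(ȳ)| ≥ Γ_α(u) > 0. -/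
open MeasureTheory Real Set
open scoped ENNReal NNReal

noncomputable section

/-- ψ(y) = ∫₀^y u(z) dz. -/
def primOf (u : ℝ → ℝ) (y : ℝ) : ℝ := ∫ z in (0:ℝ)..y, u z

/-- Wei's quantity `Γ_α(u)` for a (periodic) function on `ℝ`. -/
def Gamma (α : ℝ) (u : ℝ → ℝ) : ℝ :=
  Real.sqrt (sInf {v : ℝ | ∃ δ ∈ Set.Ioo (0:ℝ) 1, ∃ ybar c₁ c₂ : ℝ,
    v = δ ^ (-(2 * α + 3)) * ∫ y in ybar..(ybar + δ), (primOf u y - c₁ - c₂ * y) ^ 2})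
/-- Canonical distance on the torus `𝕋 = ℝ/(2πℤ)`. -/
def dTorus (x y : ℝ) : ℝ := sInf {d : ℝ | ∃ k : ℤ, d = |x - y + 2 * π * k|}

lemma dTorus_le_abs (x y : ℝ) : dTorus x y ≤ |x - y| := by
  refine csInf_le ⟨0, ?_⟩ ⟨0, by simp⟩
  rintro _ ⟨k, rfl⟩
  exact abs_nonneg _

lemma sq_Gamma_le {α : ℝ} {u : ℝ → ℝ} {δ : ℝ} (hΓ : 0 < Gamma α u) (hδ : δ ∈ Set.Ioo (0:ℝ) 1)
    (ybar c₁ c₂ : ℝ) :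
    Gamma α u ^ 2 ≤
      δ ^ (-(2 * α + 3)) * ∫ y in ybar..(ybar + δ), (primOf u y - c₁ - c₂ * y) ^ 2 := by
  rw [_root_.Gamma, Real.sq_sqrt (Real.sqrt_pos.1 hΓ).le]
  refine csInf_le ⟨0, ?_⟩ ⟨δ, hδ, ybar, c₁, c₂, rfl⟩
  rintro _ ⟨ε, hε, y, a, b, rfl⟩
  exact mul_nonneg (Real.rpow_nonneg hε.1.le _)
    (intervalIntegral.integral_nonneg (by linarith [hε.1]) fun _ _ => sq_nonneg _)

/-- The affine function tangent to the primitive at `ybar` has error at most `M * δ`. -/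
lemma abs_primOf_sub_affine_le {u : ℝ → ℝ} (hu : ∀ a b : ℝ, IntervalIntegrable u volume a b)
    {ybar δ M y : ℝ} (hM : ∀ z, |z - ybar| ≤ δ → |u z - u ybar| ≤ M)
    (hy : y ∈ Set.Icc ybar (ybar + δ)) :
    |primOf u y - (primOf u ybar - u ybar * ybar) - u ybar * y| ≤ M * δ := by
  obtain ⟨hy1, hy2⟩ := hy
  have hM0 : 0 ≤ M := (abs_nonneg _).trans (hM ybar (by simp; linarith))
  have heq : primOf u y - (primOf u ybar - u ybar * ybar) - u ybar * y
      = ∫ z in ybar..y, (u z - u ybar) := by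
    rw [intervalIntegral.integral_sub (hu _ _) intervalIntegrable_const,
      intervalIntegral.integral_const, ← intervalIntegral.integral_interval_sub_left (hu 0 y)
      (hu 0 ybar), primOf, primOf, smul_eq_mul]
    ring
  rw [heq]
  calc |∫ z in ybar..y, (u z - u ybar)| ≤ M * |y - ybar| := by
        rw [← Real.norm_eq_abs]
        refine intervalIntegral.norm_integral_le_of_norm_le_const fun z hz => ?_
        rw [Set.uIoc_of_le hy1] at hz
        exact hM z (abs_le.2 ⟨by linarith [hz.1], by linarith [hz.2]⟩)
    _ ≤ M * δ := by
        gcongr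
        exact abs_le.2 ⟨by linarith, by linarith⟩

lemma Gamma_mul_rpow_le {α : ℝ} {u : ℝ → ℝ} (hu : ∀ a b : ℝ, IntervalIntegrable u volume a b)
    (hΓ : 0 < Gamma α u) {ybar δ M : ℝ} (hδ : δ ∈ Set.Ioo (0:ℝ) 1)
    (hM : ∀ z, |z - ybar| ≤ δ → |u z - u ybar| ≤ M) :
    Gamma α u * δ ^ α ≤ M := by
  have hδ0 : 0 < δ := hδ.1
  have hM0 : 0 ≤ M := (abs_nonneg _).trans (hM ybar (by simpa using hδ0.le))
  have hint : ∫ y in ybar..(ybar + δ),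
      (primOf u y - (primOf u ybar - u ybar * ybar) - u ybar * y) ^ 2 ≤ (M * δ) ^ 2 * δ := by
    have h := intervalIntegral.norm_integral_le_of_norm_le_const (a := ybar) (b := ybar + δ)
      (C := (M * δ) ^ 2)
      (f := fun y => (primOf u y - (primOf u ybar - u ybar * ybar) - u ybar * y) ^ 2)
      fun y hy => by
        rw [Set.uIoc_of_le (by linarith)] at hy
        rw [norm_pow]
        exact pow_le_pow_left₀ (norm_nonneg _)
          (abs_primOf_sub_affine_le hu hM (Set.Ioc_subset_Icc_self hy)) 2
    rw [add_sub_cancel_left, abs_of_pos hδ0] at h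
    exact (le_abs_self _).trans h
  have hrpow : δ ^ (-(2 * α + 3)) * ((δ ^ α) ^ 2 * δ ^ 3) = 1 := by
    rw [← Real.rpow_natCast (δ ^ α), ← Real.rpow_natCast δ, ← Real.rpow_mul hδ0.le,
      ← Real.rpow_add hδ0, ← Real.rpow_add hδ0]
    convert Real.rpow_zero δ using 2
    push_cast
    ring
  have hsq : Gamma α u ^ 2 ≤ δ ^ (-(2 * α + 3)) * ((M * δ) ^ 2 * δ) :=
    (sq_Gamma_le hΓ hδ ybar _ _).trans
      (mul_le_mul_of_nonneg_left hint (Real.rpow_nonneg hδ0.le _))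
  refine (sq_le_sq₀ (by positivity) hM0).1 ?_
  calc (Gamma α u * δ ^ α) ^ 2 = Gamma α u ^ 2 * (δ ^ α) ^ 2 := by ring
    _ ≤ δ ^ (-(2 * α + 3)) * ((M * δ) ^ 2 * δ) * (δ ^ α) ^ 2 := by gcongr
    _ = M ^ 2 * (δ ^ (-(2 * α + 3)) * ((δ ^ α) ^ 2 * δ ^ 3)) := by ring
    _ = M ^ 2 := by rw [hrpow, mul_one]

/-- Lemma 4.5: if `u ∈ L¹(𝕋)` satisfies `Γ_α(u) > 0` then for every
`ȳ ∈ 𝕋` and `δ ∈ (0,1)`, `sup_{d_𝕋(z,ȳ) ≤ δ} |u(z)−u(ȳ)| ≥ Γ_α(u) δ^α`; in particular `u`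
is `α`-Hölder rough with modulus `L_α(u) ≥ Γ_α(u) > 0`. -/
theorem wei_condition_holder_rough
    (α : ℝ) (hα : 0 < α)
    (u : ℝ → ℝ) (hu_meas : Measurable u) (hu_per : Function.Periodic u (2 * π))
    (hu_int : IntegrableOn u (Set.Ioc (-π) π))
    (hΓ : 0 < Gamma α u) :
    (∀ ybar : ℝ, ∀ δ ∈ Set.Ioo (0:ℝ) 1,
      ENNReal.ofReal (Gamma α u * δ ^ α)
        ≤ ⨆ z ∈ {z : ℝ | dTorus z ybar ≤ δ}, ENNReal.ofReal |u z - u ybar|)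
    ∧ ENNReal.ofReal (Gamma α u)
        ≤ ⨅ ybar : ℝ, ⨅ δ ∈ Set.Ioo (0:ℝ) 1,
            ENNReal.ofReal (δ ^ (-α)) *
              ⨆ z ∈ {z : ℝ | dTorus z ybar ≤ δ}, ENNReal.ofReal |u z - u ybar| := by
  have hu : ∀ a b : ℝ, IntervalIntegrable u volume a b := fun a b => by
    refine hu_per.intervalIntegrable (t := -π) Real.two_pi_pos.ne' ?_ a b
    rw [intervalIntegrable_iff_integrableOn_Ioc_of_le (by linarith [Real.pi_pos])]
    rwa [show -π + 2 * π = π by ring]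
  have key : ∀ ybar : ℝ, ∀ δ ∈ Set.Ioo (0:ℝ) 1,
      ENNReal.ofReal (Gamma α u * δ ^ α)
        ≤ ⨆ z ∈ {z : ℝ | dTorus z ybar ≤ δ}, ENNReal.ofReal |u z - u ybar| := by
    intro ybar δ hδ
    generalize hS : (⨆ z ∈ {z : ℝ | dTorus z ybar ≤ δ}, ENNReal.ofReal |u z - u ybar|) = S
    rcases eq_or_ne S ⊤ with rfl | hfin
    · exact le_top
    refine ENNReal.ofReal_le_of_le_toReal (Gamma_mul_rpow_le (ybar := ybar) hu hΓ hδ fun z hz => ?_)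
    rw [← ENNReal.ofReal_le_iff_le_toReal hfin, ← hS]
    exact le_iSup₂_of_le z ((dTorus_le_abs z ybar).trans hz) le_rfl
  refine ⟨key, le_iInf fun ybar => le_iInf₂ fun δ hδ => ?_⟩
  calc ENNReal.ofReal (Gamma α u)
      = ENNReal.ofReal (δ ^ (-α)) * ENNReal.ofReal (Gamma α u * δ ^ α) := by
        rw [← ENNReal.ofReal_mul (Real.rpow_nonneg hδ.1.le _), mul_left_comm,
          ← Real.rpow_add hδ.1, neg_add_cancel, Real.rpow_zero, mul_one]
    _ ≤ _ := mul_le_mul_right (key ybar δ hδ) _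
end
end

section
/- Let α ∈ (0,1) and let u ∈ L¹(𝕋) satisfy Γ_α(u) > 0. Then: (i) for every α̃ > α the Besov–Nikolskii seminorm of u is infinite, ⟦u⟧_{B^{α̃}_{1,∞}} = +∞, so u ∉ B^{α̃}_{1,∞}(𝕋); and (ii) for every q ∈ [1,∞), ∫₀^π ( h^{−α} ∫_{−π}^{π} |u(y+h) − u(y)| dy )^q h^{−1} dh = +∞, i.e. u does not belong to B^α_{1,q}(𝕋) (identified via the finite-difference characterization of Besov spaces). -/
open MeasureTheory Real Set
open scoped ENNReal NNReal

noncomputable section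


/-- The `L¹` modulus of continuity `∫_{-π}^{π} |u (y + h) - u y| dy`. -/
def translationDefect (u : ℝ → ℝ) (h : ℝ) : ℝ≥0∞ :=
  ∫⁻ y in Set.Ioc (-π) π, ENNReal.ofReal |u (y + h) - u y|

lemma Gamma_sq_le {α : ℝ} {u : ℝ → ℝ} (hΓ : 0 < Gamma α u) {δ : ℝ} (hδ : δ ∈ Set.Ioo (0:ℝ) 1)
    (a c₁ c₂ : ℝ) :
    Gamma α u ^ 2 ≤
      δ ^ (-(2 * α + 3)) * ∫ y in a..(a + δ), (primOf u y - c₁ - c₂ * y) ^ 2 := by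
  unfold _root_.Gamma at hΓ ⊢
  rw [Real.sq_sqrt (Real.sqrt_pos.mp hΓ).le]
  refine csInf_le ⟨0, ?_⟩ ⟨δ, hδ, a, c₁, c₂, rfl⟩
  rintro v ⟨d, hd, b, e₁, e₂, rfl⟩
  exact mul_nonneg (Real.rpow_nonneg hd.1.le _)
    (intervalIntegral.integral_nonneg (by linarith [hd.1]) fun y _ => sq_nonneg _)

lemma Gamma_mul_rpow_le_integral {α : ℝ} {u : ℝ → ℝ}
    (hu : ∀ a b, IntervalIntegrable u volume a b)
    (hΓ : 0 < Gamma α u) {δ : ℝ} (hδ : δ ∈ Set.Ioo (0:ℝ) 1) (a c : ℝ) :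
    Gamma α u * δ ^ (α + 1) ≤ ∫ y in a..(a + δ), |u y - c| := by
  have hδ0 := hδ.1
  have hint : ∀ x y, IntervalIntegrable (fun z => u z - c) volume x y := fun x y =>
    (hu x y).sub intervalIntegrable_const
  set M := ∫ y in a..(a + δ), |u y - c|
  have hM0 : 0 ≤ M := intervalIntegral.integral_nonneg (by linarith) fun y _ => abs_nonneg _
  have hpt : ∀ y ∈ Set.Icc a (a + δ),
      (primOf u y - (primOf u a - c * a) - c * y) ^ 2 ≤ M ^ 2 := by
    intro y hy
    have h1 : primOf u y - (primOf u a - c * a) - c * y = ∫ z in a..y, (u z - c) := by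
      rw [intervalIntegral.integral_sub (hu a y) intervalIntegrable_const,
        intervalIntegral.integral_const, ← intervalIntegral.integral_interval_sub_left
          (hu 0 y) (hu 0 a)]
      simp only [primOf, smul_eq_mul]
      ring
    rw [h1]
    refine sq_le_sq' ?_ ?_
    all_goals
      have h2 := intervalIntegral.abs_integral_le_integral_abs (f := fun z => u z - c)
        (μ := volume) hy.1
      have h3 : ∫ z in a..y, |u z - c| ≤ M :=
        intervalIntegral.integral_mono_interval le_rfl hy.1 hy.2
          (Filter.Eventually.of_forall fun z => abs_nonneg _) (hint a (a + δ)).abs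
      have h4 := abs_le.mp (h2.trans h3)
      linarith [h4.1, h4.2]
  have hcont : Continuous (primOf u) := intervalIntegral.continuous_primitive hu 0
  have hI : ∫ y in a..(a + δ), (primOf u y - (primOf u a - c * a) - c * y) ^ 2 ≤ δ * M ^ 2 := by
    calc _ ≤ ∫ _ in a..(a + δ), M ^ 2 :=
          intervalIntegral.integral_mono_on (by linarith)
            (Continuous.intervalIntegrable (by fun_prop) _ _) intervalIntegrable_const hpt
      _ = δ * M ^ 2 := by simp
  have hG := (Gamma_sq_le hΓ hδ a (primOf u a - c * a) c).trans
    (mul_le_mul_of_nonneg_left hI (Real.rpow_nonneg hδ0.le _))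
  refine (sq_le_sq₀ (mul_nonneg hΓ.le (Real.rpow_nonneg hδ0.le _)) hM0).mp ?_
  have h5 : (δ ^ (α + 1)) ^ 2 * (δ ^ (-(2 * α + 3)) * δ) = 1 := by
    rw [← Real.rpow_natCast, ← Real.rpow_mul hδ0.le, ← Real.rpow_add_one hδ0.ne',
      ← Real.rpow_add hδ0]
    convert Real.rpow_zero δ using 2
    push_cast
    ring
  calc (Gamma α u * δ ^ (α + 1)) ^ 2 = (δ ^ (α + 1)) ^ 2 * Gamma α u ^ 2 := by ring
    _ ≤ (δ ^ (α + 1)) ^ 2 * (δ ^ (-(2 * α + 3)) * (δ * M ^ 2)) := by gcongr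
    _ = ((δ ^ (α + 1)) ^ 2 * (δ ^ (-(2 * α + 3)) * δ)) * M ^ 2 := by ring
    _ = M ^ 2 := by rw [h5, one_mul]

lemma ofReal_Gamma_le_lintegral {α : ℝ} {u : ℝ → ℝ}
    (hu : ∀ a b, IntervalIntegrable u volume a b)
    (hΓ : 0 < Gamma α u) {δ : ℝ} (hδ : δ ∈ Set.Ioo (0:ℝ) 1) (y : ℝ) :
    ENNReal.ofReal (Gamma α u * δ ^ (α + 1)) ≤
      ∫⁻ h in Set.Ioc 0 δ, ENNReal.ofReal |u (y + h) - u y| := by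
  have hint : IntervalIntegrable (fun h => |u (y + h) - u y|) volume 0 δ := by
    have := ((hu y (y + δ)).comp_add_left y).sub
      (intervalIntegrable_const (c := u y) (μ := volume))
    simpa using this.abs
  rw [← ofReal_integral_eq_lintegral_ofReal
    ((intervalIntegrable_iff_integrableOn_Ioc_of_le hδ.1.le).mp hint)
    (Filter.Eventually.of_forall fun h => abs_nonneg _),
    ← intervalIntegral.integral_of_le hδ.1.le,
    intervalIntegral.integral_comp_add_left (fun z => |u z - u y|) y, add_zero]
  exact ENNReal.ofReal_le_ofReal (Gamma_mul_rpow_le_integral hu hΓ hδ y (u y))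

lemma ofReal_Gamma_le_lintegral_translationDefect {α : ℝ} {u : ℝ → ℝ} (hm : Measurable u)
    (hu : ∀ a b, IntervalIntegrable u volume a b)
    (hΓ : 0 < Gamma α u) {δ : ℝ} (hδ : δ ∈ Set.Ioo (0:ℝ) 1) :
    ENNReal.ofReal (2 * π * Gamma α u) * ENNReal.ofReal (δ ^ (α + 1)) ≤
      ∫⁻ h in Set.Ioc 0 δ, translationDefect u h := by
  unfold translationDefect
  rw [lintegral_lintegral_swap (by
    have : Measurable (fun p : ℝ × ℝ => ENNReal.ofReal |u (p.2 + p.1) - u p.2|) := by fun_prop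
    exact this.aemeasurable)]
  calc _ = ∫⁻ _ in Set.Ioc (-π) π, ENNReal.ofReal (Gamma α u * δ ^ (α + 1)) := by
        rw [setLIntegral_const, Real.volume_Ioc,
          ← ENNReal.ofReal_mul (by positivity),
          ← ENNReal.ofReal_mul (mul_nonneg hΓ.le (Real.rpow_nonneg hδ.1.le _))]
        congr 1
        ring
    _ ≤ _ := lintegral_mono fun y => ofReal_Gamma_le_lintegral hu hΓ hδ y

lemma ofReal_Gamma_le_average {α : ℝ} (hα : 0 < α) {u : ℝ → ℝ} (hm : Measurable u)
    (hu : ∀ a b, IntervalIntegrable u volume a b)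
    (hΓ : 0 < Gamma α u) {δ : ℝ} (hδ : δ ∈ Set.Ioo (0:ℝ) 1) :
    ENNReal.ofReal (2 * π * Gamma α u) * ENNReal.ofReal δ ≤
      ∫⁻ h in Set.Ioc 0 δ, ENNReal.ofReal (h ^ (-α)) * translationDefect u h := by
  have hδ0 := hδ.1
  calc _ = ENNReal.ofReal (δ ^ (-α)) *
        (ENNReal.ofReal (2 * π * Gamma α u) * ENNReal.ofReal (δ ^ (α + 1))) := by
        rw [mul_left_comm, ← ENNReal.ofReal_mul (Real.rpow_nonneg hδ0.le _), ← Real.rpow_add hδ0]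
        simp
    _ ≤ ENNReal.ofReal (δ ^ (-α)) * ∫⁻ h in Set.Ioc 0 δ, translationDefect u h := by
        gcongr
        exact ofReal_Gamma_le_lintegral_translationDefect hm hu hΓ hδ
    _ = ∫⁻ h in Set.Ioc 0 δ, ENNReal.ofReal (δ ^ (-α)) * translationDefect u h :=
        (lintegral_const_mul' _ _ ENNReal.ofReal_ne_top).symm
    _ ≤ _ := by
        refine setLIntegral_mono' measurableSet_Ioc fun h hh => ?_
        gcongr ENNReal.ofReal ?_ * _
        exact Real.rpow_le_rpow_of_nonpos hh.1 hh.2 (by linarith)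

lemma besovSeminorm_eq_top {α α' : ℝ} (hα : 0 < α) (hαα' : α < α') {u : ℝ → ℝ}
    (hm : Measurable u) (hu : ∀ a b, IntervalIntegrable u volume a b)
    (hΓ : 0 < Gamma α u) : besovSeminorm α' u = ⊤ := by
  by_contra hC
  have key : ∀ δ ∈ Set.Ioo (0:ℝ) 1, ENNReal.ofReal (2 * π * Gamma α u) ≤
      ENNReal.ofReal (δ ^ (α' - α)) * besovSeminorm α' u := by
    intro δ hδ
    have hδ0 := hδ.1
    rw [← ENNReal.mul_le_mul_iff_left (c := ENNReal.ofReal δ) (by simpa using hδ0)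
      ENNReal.ofReal_ne_top]
    refine (ofReal_Gamma_le_average hα hm hu hΓ hδ).trans ?_
    calc _ ≤ ∫⁻ _ in Set.Ioc 0 δ, ENNReal.ofReal (δ ^ (α' - α)) * besovSeminorm α' u := by
          refine setLIntegral_mono' measurableSet_Ioc fun h hh => ?_
          have h1 : ENNReal.ofReal (h ^ (-α')) * translationDefect u h ≤ besovSeminorm α' u :=
            le_iSup₂ (f := fun h (_ : h ∈ Set.Ioc (0:ℝ) π) =>
              ENNReal.ofReal (h ^ (-α')) * translationDefect u h) h
              ⟨hh.1, by linarith [hh.2, hδ.2, Real.pi_gt_three]⟩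
          calc _ = ENNReal.ofReal (h ^ (α' - α)) *
                (ENNReal.ofReal (h ^ (-α')) * translationDefect u h) := by
                rw [← mul_assoc, ← ENNReal.ofReal_mul (Real.rpow_nonneg hh.1.le _),
                  ← Real.rpow_add hh.1]
                congr 3
                ring
            _ ≤ _ := by
                gcongr ENNReal.ofReal ?_ * ?_
                exact Real.rpow_le_rpow hh.1.le hh.2 (by linarith)
      _ = _ := by rw [setLIntegral_const, Real.volume_Ioc, sub_zero]
  have hlim : Filter.Tendsto (fun δ : ℝ => ENNReal.ofReal (δ ^ (α' - α)) * besovSeminorm α' u)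
      (nhdsWithin 0 (Set.Ioi 0)) (nhds 0) := by
    have h1 : Filter.Tendsto (fun δ : ℝ => δ ^ (α' - α)) (nhdsWithin 0 (Set.Ioi 0)) (nhds 0) := by
      have := (Real.continuousAt_rpow_const 0 (α' - α) (Or.inr (by linarith))).tendsto
      rw [Real.zero_rpow (by linarith)] at this
      exact this.mono_left nhdsWithin_le_nhds
    have h2 := ENNReal.Tendsto.mul_const (ENNReal.tendsto_ofReal h1) (Or.inr hC)
    simpa using h2
  have hle := ge_of_tendsto hlim
    (Filter.eventually_of_mem (Ioo_mem_nhdsGT one_pos) key)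
  rw [nonpos_iff_eq_zero, ENNReal.ofReal_eq_zero] at hle
  have : 0 < 2 * π * Gamma α u := by positivity
  linarith

lemma ENNReal.le_add_mul_rpow {c : ℝ≥0∞} (hc : c ≠ 0) (hc' : c ≠ ⊤) {q : ℝ} (hq : 1 ≤ q)
    (x : ℝ≥0∞) : x ≤ c + c ^ (1 - q) * x ^ q := by
  rcases le_total x c with h | h
  · exact h.trans le_self_add
  · refine le_trans ?_ le_add_self
    have hx : x ≠ 0 := fun h0 => hc (le_zero_iff.mp (h0 ▸ h))
    rcases eq_or_ne x ⊤ with rfl | hxt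
    · rw [ENNReal.top_rpow_of_pos (by linarith), ENNReal.mul_top]
      exact (ENNReal.rpow_pos (pos_iff_ne_zero.mpr hc) hc').ne'
    calc x = x ^ (1 - q) * x ^ q := by
          rw [← ENNReal.rpow_add _ _ hx hxt, sub_add_cancel, ENNReal.rpow_one]
      _ ≤ c ^ (1 - q) * x ^ q := by
          gcongr ?_ * _
          rw [← neg_sub q 1, ENNReal.rpow_neg, ENNReal.rpow_neg]
          exact ENNReal.inv_le_inv.mpr (ENNReal.rpow_le_rpow h (by linarith))

lemma lintegral_besov_eq_top {α : ℝ} (hα : 0 < α) {u : ℝ → ℝ}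
    (hm : Measurable u) (hu : ∀ a b, IntervalIntegrable u volume a b)
    (hΓ : 0 < Gamma α u) {q : ℝ} (hq : 1 ≤ q) :
    ∫⁻ h in Set.Ioc (0:ℝ) π, (ENNReal.ofReal (h ^ (-α)) * translationDefect u h) ^ q
      * ENNReal.ofReal h⁻¹ = ⊤ := by
  by_contra hfin
  set g : ℝ → ℝ≥0∞ := fun h =>
    (ENNReal.ofReal (h ^ (-α)) * translationDefect u h) ^ q * ENNReal.ofReal h⁻¹ with hg
  set c := ENNReal.ofReal (π * Gamma α u) with hc
  have hc0 : c ≠ 0 := by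
    have : 0 < π * Gamma α u := by positivity
    simpa [hc] using this
  have hct : c ≠ ⊤ := ENNReal.ofReal_ne_top
  have hcq : c ^ (1 - q) ≠ ⊤ := by
    simp [ENNReal.rpow_eq_top_iff, hc0, hct]
  have key : ∀ δ ∈ Set.Ioo (0:ℝ) 1, c ≤ c ^ (1 - q) * ∫⁻ h in Set.Ioc 0 δ, g h := by
    intro δ hδ
    have hδ0 := hδ.1
    have h1 : (c + c) * ENNReal.ofReal δ ≤
        (c + c ^ (1 - q) * ∫⁻ h in Set.Ioc 0 δ, g h) * ENNReal.ofReal δ := by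
      calc _ = ENNReal.ofReal (2 * π * Gamma α u) * ENNReal.ofReal δ := by
            rw [hc, ← ENNReal.ofReal_add (by positivity) (by positivity)]
            congr 2
            ring
        _ ≤ _ := ofReal_Gamma_le_average hα hm hu hΓ hδ
        _ ≤ ∫⁻ h in Set.Ioc 0 δ, (c + c ^ (1 - q) * ENNReal.ofReal δ * g h) := by
            refine setLIntegral_mono' measurableSet_Ioc fun h hh => ?_
            refine (ENNReal.le_add_mul_rpow hc0 hct hq _).trans ?_
            rw [mul_assoc]
            gcongr
            have h2 : 1 ≤ ENNReal.ofReal δ * ENNReal.ofReal h⁻¹ := by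
              rw [← ENNReal.ofReal_mul hδ0.le, ENNReal.one_le_ofReal, ← div_eq_mul_inv,
                one_le_div hh.1]
              exact hh.2
            rw [hg]
            simp only
            rw [mul_left_comm]
            exact le_mul_of_one_le_right zero_le h2
        _ = _ := by
            rw [lintegral_add_left measurable_const, setLIntegral_const, Real.volume_Ioc,
              sub_zero, lintegral_const_mul' _ _ (ENNReal.mul_ne_top hcq ENNReal.ofReal_ne_top)]
            ring
    rw [ENNReal.mul_le_mul_iff_left (by simpa using hδ0) ENNReal.ofReal_ne_top] at h1
    exact (ENNReal.add_le_add_iff_left hct).mp h1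
  have hlim0 : Filter.Tendsto (fun δ : ℝ => ∫⁻ h in Set.Ioc 0 δ, g h)
      (nhdsWithin 0 (Set.Ioi 0)) (nhds 0) := by
    have hvol : Filter.Tendsto (fun δ : ℝ => (volume.restrict (Set.Ioc 0 π)) (Set.Ioc 0 δ))
        (nhdsWithin 0 (Set.Ioi 0)) (nhds 0) := by
      have h1 : Filter.Tendsto (fun δ : ℝ => ENNReal.ofReal δ)
          (nhdsWithin 0 (Set.Ioi 0)) (nhds 0) := by
        simpa using (ENNReal.continuous_ofReal.tendsto 0).mono_left nhdsWithin_le_nhds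
      refine tendsto_of_tendsto_of_tendsto_of_le_of_le tendsto_const_nhds h1
        (fun _ => zero_le) fun δ => ?_
      exact (Measure.restrict_apply_le _ _).trans (by simp)
    refine (tendsto_setLIntegral_zero hfin hvol).congr' ?_
    filter_upwards [Ioo_mem_nhdsGT one_pos] with δ hδ
    rw [Measure.restrict_restrict measurableSet_Ioc, Set.inter_eq_left.mpr]
    exact Set.Ioc_subset_Ioc_right (by linarith [hδ.2, Real.pi_gt_three])
  have hlim := ENNReal.Tendsto.const_mul (a := c ^ (1 - q)) hlim0 (Or.inr hcq)
  rw [mul_zero] at hlim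
  exact hc0 (nonpos_iff_eq_zero.mp (ge_of_tendsto hlim
    (Filter.eventually_of_mem (Ioo_mem_nhdsGT one_pos) key)))

/-- Lemma 4.6: if `u ∈ L¹(𝕋)` satisfies Wei's condition `Γ_α(u) > 0`
with `α ∈ (0,1)` then (i) `⟦u⟧_{B^α̃_{1,∞}} = +∞` for every `α̃ > α`, so `u ∉ B^α̃_{1,∞}(𝕋)`;
and (ii) for every `q ∈ [1,∞)`,
`∫₀^π (h^{−α} ∫_{−π}^π |u(y+h)−u(y)| dy)^q h^{−1} dh = +∞`, i.e. `u ∉ B^α_{1,q}(𝕋)`. -/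
theorem wei_condition_not_besov
    (α : ℝ) (hα : α ∈ Set.Ioo (0:ℝ) 1)
    (u : ℝ → ℝ) (hu_meas : Measurable u) (hu_per : Function.Periodic u (2 * π))
    (hu_int : IntegrableOn u (Set.Ioc (-π) π))
    (hΓ : 0 < Gamma α u) :
    (∀ α' : ℝ, α < α' → besovSeminorm α' u = ⊤ ∧ besovNorm α' u = ⊤)
    ∧ (∀ q : ℝ, 1 ≤ q →
        (∫⁻ h in Set.Ioc (0:ℝ) π,
          (ENNReal.ofReal (h ^ (-α)) *
            ∫⁻ y in Set.Ioc (-π) π, ENNReal.ofReal |u (y + h) - u y|) ^ q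
          * ENNReal.ofReal h⁻¹) = ⊤) := by
  have hu : ∀ a b, IntervalIntegrable u volume a b := fun a b => by
    refine hu_per.intervalIntegrable (by positivity) (t := -π) ?_ a b
    rw [show -π + 2 * π = π by ring]
    exact (intervalIntegrable_iff_integrableOn_Ioc_of_le (by linarith [Real.pi_pos])).mpr hu_int
  refine ⟨fun α' hα' => ?_, fun q hq => lintegral_besov_eq_top hα.1 hu_meas hu hΓ hq⟩
  have h := besovSeminorm_eq_top hα.1 hα' hu_meas hu hΓ
  exact ⟨h, by rw [besovNorm, h, add_top]⟩
end
end

section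
/- Let α > 0, δ > 0, ȳ ∈ ℝ and let ψ : ℝ → ℝ be measurable and locally square integrable. Then δ^{−2α−3} · inf_{c₁,c₂ ∈ ℝ} ∫_{ȳ}^{ȳ+3δ} |ψ(y) − c₁ − c₂ y|² dy ≥ (1/12) ( ∫_{ȳ}^{ȳ+δ} |Δ²_δ ψ(y)|^{−1/(1+α)} dy )^{−2(1+α)}, with the conventions 0^{−1/(1+α)} = +∞ and (+∞)^{−2(1+α)} = 0. -/
open MeasureTheory Real Set
open scoped ENNReal NNReal

noncomputable section

/-- Second difference operator `Δ²_δ f(y) = f(y+2δ) − 2f(y+δ) + f(y)`. -/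
def secondDiff (δ : ℝ) (f : ℝ → ℝ) (y : ℝ) : ℝ := f (y + 2 * δ) - 2 * f (y + δ) + f y

/-- `G_α(ȳ,δ) = ∫_{ȳ}^{ȳ+δ} |Δ²_δ ψ(y)|^{−1/(1+α)} dy`, with `0^{−1/(1+α)} = +∞`. -/
def Gfun (α : ℝ) (ψ : ℝ → ℝ) (ybar δ : ℝ) : ℝ≥0∞ :=
  ∫⁻ y in Set.Ioc ybar (ybar + δ),
    (ENNReal.ofReal |secondDiff δ ψ y|) ^ (-(1 / (1 + α)))

theorem setLIntegral_Ioc_comp_add_right (F : ℝ → ℝ≥0∞) (a b c : ℝ) :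
    ∫⁻ y in Ioc a b, F (y + c) = ∫⁻ y in Ioc (a + c) (b + c), F y := by
  have h := (measurePreserving_add_right (volume : Measure ℝ) c).setLIntegral_comp_preimage_emb
    (measurableEmbedding_addRight c) F (Ioc (a + c) (b + c))
  simpa using h

theorem secondDiff_sub_affine (δ : ℝ) (f : ℝ → ℝ) (c₁ c₂ y : ℝ) :
    secondDiff δ (fun x => f x - c₁ - c₂ * x) y = secondDiff δ f y := by
  simp only [secondDiff]
  ring

theorem measurable_secondDiff (δ : ℝ) {f : ℝ → ℝ} (hf : Measurable f) :
    Measurable (secondDiff δ f) := by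
  unfold secondDiff
  fun_prop

theorem lintegral_secondDiff_sq_le {δ : ℝ} (hδ : 0 < δ) (a : ℝ) {f : ℝ → ℝ}
    (hf : Measurable f) :
    ∫⁻ y in Ioc a (a + δ), ENNReal.ofReal (secondDiff δ f y ^ 2)
      ≤ 6 * ∫⁻ y in Ioc a (a + 3 * δ), ENNReal.ofReal (f y ^ 2) := by
  set F : ℝ → ℝ≥0∞ := fun y => ENNReal.ofReal (f y ^ 2) with hF
  have hFm : Measurable F := by fun_prop
  have hpt (y : ℝ) : ENNReal.ofReal (secondDiff δ f y ^ 2)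
      ≤ 6 * (F y + F (y + δ) + F (y + 2 * δ)) := by
    simp only [hF]
    rw [← ENNReal.ofReal_add (by positivity) (by positivity),
      ← ENNReal.ofReal_add (by positivity) (by positivity),
      show (6 : ℝ≥0∞) = ENNReal.ofReal 6 by simp, ← ENNReal.ofReal_mul (by norm_num)]
    apply ENNReal.ofReal_le_ofReal
    unfold secondDiff
    nlinarith [sq_nonneg (f (y + 2 * δ) - f y), sq_nonneg (f (y + 2 * δ) + f (y + δ) + f y),
      sq_nonneg (2 * f y + f (y + δ)), sq_nonneg (2 * f (y + 2 * δ) + f (y + δ))]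
  calc ∫⁻ y in Ioc a (a + δ), ENNReal.ofReal (secondDiff δ f y ^ 2)
      ≤ ∫⁻ y in Ioc a (a + δ), 6 * (F y + F (y + δ) + F (y + 2 * δ)) := lintegral_mono hpt
    _ = 6 * ((∫⁻ y in Ioc a (a + δ), F y) + (∫⁻ y in Ioc (a + δ) (a + 2 * δ), F y)
          + ∫⁻ y in Ioc (a + 2 * δ) (a + 3 * δ), F y) := by
        rw [lintegral_const_mul _ (by fun_prop), lintegral_add_left (by fun_prop),
          lintegral_add_left (by fun_prop), setLIntegral_Ioc_comp_add_right,
          setLIntegral_Ioc_comp_add_right]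
        ring_nf
    _ = 6 * ∫⁻ y in Ioc a (a + 3 * δ), F y := by
        rw [← lintegral_union measurableSet_Ioc (Ioc_disjoint_Ioc_of_le le_rfl),
          Ioc_union_Ioc_eq_Ioc (by linarith) (by linarith),
          ← lintegral_union measurableSet_Ioc (Ioc_disjoint_Ioc_of_le le_rfl),
          Ioc_union_Ioc_eq_Ioc (by linarith) (by linarith)]

theorem integrableOn_sub_affine_sq {f : ℝ → ℝ} (hf : Measurable f) {a b : ℝ}
    (hsq : IntegrableOn (fun y => f y ^ 2) (Ioc a b)) (c₁ c₂ : ℝ) :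
    IntegrableOn (fun y => (f y - c₁ - c₂ * y) ^ 2) (Ioc a b) := by
  have hc : IntegrableOn (fun y : ℝ => (c₁ + c₂ * y) ^ 2) (Ioc a b) :=
    (Continuous.integrableOn_Icc (by fun_prop)).mono_set Ioc_subset_Icc_self
  refine ((hsq.add hc).const_mul 2).mono' (by fun_prop) (ae_of_all _ fun y => ?_)
  rw [Real.norm_of_nonneg (by positivity)]
  simp only [Pi.add_apply]
  nlinarith [sq_nonneg (f y + (c₁ + c₂ * y))]

/-- Hölder's inequality applied to `1 = (g²)^{1/(2α+3)} (g^{-1/(1+α)})^{(2α+2)/(2α+3)}`. -/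
theorem measure_rpow_le_lintegral_sq_mul {X : Type*} [MeasurableSpace X] (μ : Measure X)
    {α : ℝ} (hα : 0 < α) {g : X → ℝ≥0∞} (hg : AEMeasurable g μ) (hg_top : ∀ᵐ x ∂μ, g x ≠ ∞)
    (hfin : ∫⁻ x, g x ^ (-(1 / (1 + α))) ∂μ ≠ ∞) :
    μ univ ^ (2 * α + 3)
      ≤ (∫⁻ x, g x ^ (2 : ℝ) ∂μ) * (∫⁻ x, g x ^ (-(1 / (1 + α))) ∂μ) ^ (2 * (1 + α)) := by
  have hp : (0 : ℝ) < 2 * α + 3 := by linarith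
  have h1 : (0 : ℝ) < 1 + α := by linarith
  have hne : ∀ᵐ x ∂μ, g x ≠ 0 := by
    filter_upwards [ae_lt_top' (hg.pow_const _) hfin] with x hx h0
    rw [h0, ENNReal.zero_rpow_of_neg (by simpa using h1)] at hx
    exact lt_irrefl _ hx
  have hone : μ univ = ∫⁻ x, (g x ^ (2 : ℝ)) ^ (1 / (2 * α + 3)) *
      (g x ^ (-(1 / (1 + α)))) ^ (2 * (1 + α) / (2 * α + 3)) ∂μ := by
    rw [← lintegral_one]
    refine lintegral_congr_ae ?_
    filter_upwards [hne, hg_top] with x h0 ht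
    rw [← ENNReal.rpow_mul, ← ENNReal.rpow_mul, ← ENNReal.rpow_add _ _ h0 ht]
    rw [show 2 * (1 / (2 * α + 3)) + -(1 / (1 + α)) * (2 * (1 + α) / (2 * α + 3)) = 0 by
      field_simp; ring, ENNReal.rpow_zero]
  have hholder := ENNReal.lintegral_mul_norm_pow_le (μ := μ) (hg.pow_const (2 : ℝ))
    (hg.pow_const (-(1 / (1 + α)))) (p := 1 / (2 * α + 3))
    (q := 2 * (1 + α) / (2 * α + 3)) (by positivity) (by positivity)
    (by field_simp; ring)
  rw [← hone] at hholder
  refine (ENNReal.rpow_le_rpow hholder hp.le).trans_eq ?_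
  rw [ENNReal.mul_rpow_of_nonneg _ _ hp.le, ← ENNReal.rpow_mul, ← ENNReal.rpow_mul,
    one_div_mul_cancel hp.ne', div_mul_cancel₀ _ hp.ne', ENNReal.rpow_one]

theorem Gfun_rpow_neg_le {α δ : ℝ} (hα : 0 < α) (hδ : 0 < δ) (a : ℝ) {f : ℝ → ℝ}
    (hf : Measurable f) :
    Gfun α f a δ ^ (-(2 * (1 + α))) ≤ ENNReal.ofReal (δ ^ (-(2 * α + 3))) *
      ∫⁻ y in Ioc a (a + δ), ENNReal.ofReal (secondDiff δ f y ^ 2) := by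
  by_cases htop : Gfun α f a δ = ∞
  · rw [htop, ENNReal.top_rpow_of_neg (by linarith)]
    exact zero_le
  have hp : (0 : ℝ) < 2 * α + 3 := by linarith
  have hq : (0 : ℝ) < 2 * (1 + α) := by linarith
  have hm := measurable_secondDiff δ hf
  have h := measure_rpow_le_lintegral_sq_mul (volume.restrict (Ioc a (a + δ))) hα
    (g := fun y => ENNReal.ofReal |secondDiff δ f y|) (by fun_prop)
    (ae_of_all _ fun _ => ENNReal.ofReal_ne_top) htop
  have hsq (y : ℝ) : ENNReal.ofReal |secondDiff δ f y| ^ (2 : ℝ)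
      = ENNReal.ofReal (secondDiff δ f y ^ 2) := by
    rw [ENNReal.ofReal_rpow_of_nonneg (abs_nonneg _) (by norm_num), Real.rpow_two, sq_abs]
  simp only [hsq] at h
  change _ ≤ _ * Gfun α f a δ ^ (2 * (1 + α)) at h
  rw [Measure.restrict_apply_univ, Real.volume_Ioc, add_sub_cancel_left,
    ENNReal.ofReal_rpow_of_pos hδ] at h
  have hδp : ENNReal.ofReal (δ ^ (2 * α + 3)) ≠ 0 := by
    rw [Ne, ENNReal.ofReal_eq_zero, not_le]
    positivity
  have hG0 : Gfun α f a δ ^ (2 * (1 + α)) ≠ 0 := fun h0 => by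
    rw [h0, mul_zero] at h
    exact hδp (le_antisymm h zero_le)
  have hGtop : Gfun α f a δ ^ (2 * (1 + α)) ≠ ∞ := ENNReal.rpow_ne_top_of_nonneg hq.le htop
  rw [ENNReal.rpow_neg, Real.rpow_neg hδ.le, ENNReal.ofReal_inv_of_pos (by positivity),
    ENNReal.inv_le_iff_le_mul (fun _ => hG0) (fun h' => absurd h' hGtop), mul_left_comm,
    ← ENNReal.div_eq_inv_mul, mul_comm (Gfun _ _ _ _ ^ _),
    ENNReal.le_div_iff_mul_le (.inl hδp) (.inl ENNReal.ofReal_ne_top), one_mul]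
  exact h

/-- Lemma 4.8: for any `α, δ > 0`, `ȳ ∈ ℝ` and any locally square
integrable `ψ`,
`δ^{−2α−3} inf_{c₁,c₂} ∫_{ȳ}^{ȳ+3δ} |ψ(y)−c₁−c₂y|² dy
  ≥ (1/12) (∫_{ȳ}^{ȳ+δ} |Δ²_δ ψ(y)|^{−1/(1+α)} dy)^{−2(1+α)}`,
with the conventions `0^{−1/(1+α)} = +∞` and `(+∞)^{−2(1+α)} = 0`. -/
theorem second_difference_lower_bound
    (α δ ybar : ℝ) (hα : 0 < α) (hδ : 0 < δ)
    (ψ : ℝ → ℝ) (hψ_meas : Measurable ψ)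
    (hψ_sq : ∀ a b : ℝ, IntegrableOn (fun y => (ψ y) ^ 2) (Set.Ioc a b)) :
    (1 / 12 : ℝ≥0∞) * (Gfun α ψ ybar δ) ^ (-(2 * (1 + α)))
      ≤ ENNReal.ofReal (δ ^ (-(2 * α + 3)) *
          sInf {v : ℝ | ∃ c₁ c₂ : ℝ,
            v = ∫ y in ybar..(ybar + 3 * δ), (ψ y - c₁ - c₂ * y) ^ 2}) := by
  set I := ∫⁻ y in Ioc ybar (ybar + δ), ENNReal.ofReal (secondDiff δ ψ y ^ 2) with hI
  have hle (c₁ c₂ : ℝ) : I ≤ 6 * ENNReal.ofReal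
      (∫ y in ybar..(ybar + 3 * δ), (ψ y - c₁ - c₂ * y) ^ 2) := by
    rw [intervalIntegral.integral_of_le (by linarith), ofReal_integral_eq_lintegral_ofReal
      (integrableOn_sub_affine_sq hψ_meas (hψ_sq _ _) c₁ c₂)
      (ae_of_all _ fun _ => sq_nonneg _)]
    simpa only [secondDiff_sub_affine] using
      lintegral_secondDiff_sq_le hδ ybar (f := fun x => ψ x - c₁ - c₂ * x) (by fun_prop)
  have hI_top : I ≠ ∞ := ne_top_of_le_ne_top (by finiteness) (hle 0 0)
  have hinf : I.toReal / 6 ≤ sInf {v : ℝ | ∃ c₁ c₂ : ℝ,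
      v = ∫ y in ybar..(ybar + 3 * δ), (ψ y - c₁ - c₂ * y) ^ 2} := by
    refine le_csInf ⟨_, 0, 0, rfl⟩ ?_
    rintro _ ⟨c₁, c₂, rfl⟩
    have h := ENNReal.toReal_mono (by finiteness) (hle c₁ c₂)
    rw [ENNReal.toReal_mul, ENNReal.toReal_ofReal (intervalIntegral.integral_nonneg
      (by linarith) fun _ _ => sq_nonneg _), ENNReal.toReal_ofNat] at h
    linarith
  calc (1 / 12 : ℝ≥0∞) * Gfun α ψ ybar δ ^ (-(2 * (1 + α)))
      ≤ (1 / 6) * (ENNReal.ofReal (δ ^ (-(2 * α + 3))) * I) := by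
        gcongr
        · norm_num
        · exact Gfun_rpow_neg_le hα hδ ybar hψ_meas
    _ = ENNReal.ofReal (δ ^ (-(2 * α + 3)) * (I.toReal / 6)) := by
        rw [ENNReal.ofReal_mul (by positivity), ENNReal.ofReal_div_of_pos (by norm_num),
          ENNReal.ofReal_toReal hI_top, ENNReal.ofReal_ofNat, one_div, div_eq_mul_inv]
        ring
    _ ≤ _ := ENNReal.ofReal_le_ofReal (by gcongr)
end
end

section
/- Let α ∈ (0,1) and let u = (u_y)_{y∈[0,π]} be a jointly measurable real-valued stochastic process with a.s. integrable sample paths; extend each path by zero outside [0,π] and set ψ(y) := ∫₀^y u_z dz and G_α(ȳ,δ) := ∫_{ȳ}^{ȳ+δ} |Δ²_δ ψ(y)|^{−1/(1+α)} dy. Suppose there exist λ, κ > 0 such that sup_{δ ∈ (0,1), ȳ ∈ [0,π−δ]} E[ exp(λ G_α(ȳ,δ)) ] ≤ κ. Then for every β > α one has P( Γ_β(u) > 0 ) = 1. -/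
open MeasureTheory Real Set
open scoped ENNReal NNReal

noncomputable section

/-- ψ(y) = ∫₀^y u(z) dz for `u ∈ L¹(0,π)` extended by zero outside `[0,π]`. -/
def primOfI (u : ℝ → ℝ) (y : ℝ) : ℝ :=
  ∫ z in (0:ℝ)..y, Set.indicator (Set.Icc 0 π) u z

/-- Wei's quantity `Γ_β(u)` for `u ∈ L¹(0,π)` (extended by zero outside `[0,π]`). -/
def GammaI (β : ℝ) (u : ℝ → ℝ) : ℝ :=
  Real.sqrt (sInf {v : ℝ | ∃ δ ∈ Set.Ioo (0:ℝ) 1, ∃ ybar ∈ Set.Icc (0:ℝ) (π - δ),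
    ∃ c₁ c₂ : ℝ,
    v = δ ^ (-(2 * β + 3)) * ∫ y in ybar..(ybar + δ), (primOfI u y - c₁ - c₂ * y) ^ 2})

/-- `exp(l·x)` for `x ∈ ℝ≥0∞`, with value `+∞` when `x = +∞`. -/
def expEnn (l : ℝ) (x : ℝ≥0∞) : ℝ≥0∞ :=
  if x = ⊤ then ⊤ else ENNReal.ofReal (Real.exp (l * x.toReal))

/-- A negative moment bound on `D` over an interval bounds its `L²` mass from below. -/
theorem sq_integral_ge_of_negative_moment_le {α : ℝ} (hα : 0 < α) {D : ℝ → ℝ}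
    (hD : Continuous D) {a d M : ℝ} (hd : 0 < d) (hM : 0 < M)
    (hG : ∫⁻ y in Set.Ioc a (a + d), (ENNReal.ofReal |D y|) ^ (-(1 / (1 + α)))
      ≤ ENNReal.ofReal M) :
    d / 2 * ((d / (2 * M)) ^ (1 + α)) ^ 2 ≤ ∫ y in a..(a + d), D y ^ 2 := by
  have hr : 0 < d / (2 * M) := by positivity
  set L : ℝ := (d / (2 * M)) ^ (1 + α) with hL
  have hLpos : 0 < L := Real.rpow_pos_of_pos hr _
  have hp : (0:ℝ) < 1 / (1 + α) := by positivity
  have hLp : L ^ (1 / (1 + α)) = d / (2 * M) := by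
    rw [hL, ← Real.rpow_mul hr.le, mul_one_div_cancel (by positivity), Real.rpow_one]
  have hpt : ∀ y, (1 : ℝ≥0∞) ≤ ENNReal.ofReal (D y ^ 2 / L ^ 2)
      + ENNReal.ofReal (d / (2 * M)) * (ENNReal.ofReal |D y|) ^ (-(1 / (1 + α))) := by
    intro y
    rcases le_total L |D y| with h | h
    · refine le_add_right ?_
      rw [← ENNReal.ofReal_one]
      apply ENNReal.ofReal_le_ofReal
      rw [one_le_div (by positivity), ← sq_abs (D y)]
      gcongr
    · refine le_add_left ?_
      have h1 : (ENNReal.ofReal |D y|) ^ (1 / (1 + α)) ≤ ENNReal.ofReal (d / (2 * M)) := by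
        rw [← hLp, ← ENNReal.ofReal_rpow_of_pos hLpos]
        exact ENNReal.rpow_le_rpow (ENNReal.ofReal_le_ofReal h) hp.le
      rw [ENNReal.rpow_neg]
      calc (1 : ℝ≥0∞) = ENNReal.ofReal (d / (2 * M)) * (ENNReal.ofReal (d / (2 * M)))⁻¹ :=
            (ENNReal.mul_inv_cancel (ENNReal.ofReal_pos.2 hr).ne' ENNReal.ofReal_ne_top).symm
        _ ≤ _ := by gcongr
  have hint : IntegrableOn (fun y => D y ^ 2 / L ^ 2) (Set.Ioc a (a + d)) :=
    ((hD.pow 2).div_const _).integrableOn_Ioc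
  have hI : 0 ≤ ∫ y in Set.Ioc a (a + d), D y ^ 2 / L ^ 2 :=
    integral_nonneg fun y => by positivity
  have hmain : ENNReal.ofReal d ≤
      ENNReal.ofReal (∫ y in Set.Ioc a (a + d), D y ^ 2 / L ^ 2) + ENNReal.ofReal (d / 2) := by
    calc ENNReal.ofReal d = ∫⁻ _ in Set.Ioc a (a + d), (1 : ℝ≥0∞) := by simp
      _ ≤ ∫⁻ y in Set.Ioc a (a + d), (ENNReal.ofReal (D y ^ 2 / L ^ 2)
          + ENNReal.ofReal (d / (2 * M)) * (ENNReal.ofReal |D y|) ^ (-(1 / (1 + α)))) :=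
        lintegral_mono hpt
      _ = ENNReal.ofReal (∫ y in Set.Ioc a (a + d), D y ^ 2 / L ^ 2)
          + ENNReal.ofReal (d / (2 * M)) *
            ∫⁻ y in Set.Ioc a (a + d), (ENNReal.ofReal |D y|) ^ (-(1 / (1 + α))) := by
        rw [lintegral_add_left
            (by fun_prop : Continuous fun y => D y ^ 2 / L ^ 2).measurable.ennreal_ofReal,
          lintegral_const_mul' _ _ ENNReal.ofReal_ne_top,
          ofReal_integral_eq_lintegral_ofReal hint (ae_of_all _ fun y => by positivity)]
      _ ≤ ENNReal.ofReal (∫ y in Set.Ioc a (a + d), D y ^ 2 / L ^ 2)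
          + ENNReal.ofReal (d / (2 * M)) * ENNReal.ofReal M := by gcongr
      _ = _ := by
        rw [← ENNReal.ofReal_mul hr.le]
        congr 2
        field_simp
  rw [← ENNReal.ofReal_add hI (by positivity), ENNReal.ofReal_le_ofReal_iff (by positivity),
    integral_div] at hmain
  rw [intervalIntegral.integral_of_le (by linarith)]
  have h2 : d / 2 ≤ (∫ y in Set.Ioc a (a + d), D y ^ 2) / L ^ 2 := by linarith
  rwa [le_div_iff₀ (by positivity)] at h2

/-- Second differences annihilate affine functions, so their `L²` mass is controlled by the `L²`
distance to any affine function on a larger window. -/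
theorem integral_secondDiff_sq_le {ψ : ℝ → ℝ} (hψ : Continuous ψ) {x δ a d : ℝ} (hd : 0 < d)
    (hxa : x ≤ a) (ha : a + 3 * d ≤ x + δ) (c₁ c₂ : ℝ) :
    ∫ y in a..(a + d), secondDiff d ψ y ^ 2
      ≤ 18 * ∫ y in x..(x + δ), (ψ y - c₁ - c₂ * y) ^ 2 := by
  set f : ℝ → ℝ := fun y => ψ y - c₁ - c₂ * y with hf
  have hfc : Continuous f := by fun_prop
  have hshift : ∀ s, 0 ≤ s → s ≤ 2 * d →
      ∫ y in a..(a + d), f (y + s) ^ 2 ≤ ∫ y in x..(x + δ), f y ^ 2 := by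
    intro s hs hs2
    rw [intervalIntegral.integral_comp_add_right (fun y => f y ^ 2) s]
    exact intervalIntegral.integral_mono_interval (by linarith) (by linarith) (by linarith)
      (ae_of_all _ fun y => sq_nonneg _) ((hfc.pow 2).intervalIntegrable _ _)
  have h0 := hshift 0 le_rfl (by linarith)
  have h1 := hshift d hd.le (by linarith)
  have h2 := hshift (2 * d) (by linarith) le_rfl
  have hle : ∫ y in a..(a + d), secondDiff d ψ y ^ 2
      ≤ ∫ y in a..(a + d), 6 * (f (y + 0) ^ 2 + f (y + d) ^ 2 + f (y + 2 * d) ^ 2) := by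
    refine intervalIntegral.integral_mono_on (by linarith)
      (Continuous.intervalIntegrable (by unfold secondDiff; fun_prop) _ _)
      (Continuous.intervalIntegrable (by fun_prop) _ _) fun y _ => ?_
    have : secondDiff d ψ y = f (y + 2 * d) - 2 * f (y + d) + f (y + 0) := by
      simp only [secondDiff, hf, add_zero]; ring
    rw [this]
    nlinarith [sq_nonneg (2 * f (y + 2 * d) + f (y + d)), sq_nonneg (f (y + 2 * d) - f (y + 0)),
      sq_nonneg (2 * f (y + 0) + f (y + d))]
  rw [intervalIntegral.integral_const_mul, intervalIntegral.integral_add,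
    intervalIntegral.integral_add] at hle
  · linarith
  all_goals exact Continuous.intervalIntegrable (by fun_prop) _ _

/-- Bounds on the negative moments of second differences on the dyadic grid, polynomially growing
in the inverse mesh, force `Γ_β > 0`. -/
theorem GammaI_pos_of_dyadic_bound {α β : ℝ} (hα : 0 < α) (hαβ : α < β) {v : ℝ → ℝ}
    (hψ : Continuous (primOfI v)) {C : ℝ} (hC : 0 < C)
    (hG : ∀ n k : ℕ, 1 ≤ n → (k : ℝ) * (1 / 2) ^ n ≤ π - (1 / 2) ^ n →
      Gfun α (primOfI v) (k * (1 / 2) ^ n) ((1 / 2) ^ n)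
        ≤ ENNReal.ofReal (C * (((1 / 2 : ℝ) ^ n) ^ (-((β - α) / (1 + α)))))) :
    0 < GammaI β v := by
  set c : ℝ := (1 / (2 * C)) ^ (1 + α) with hc
  have hcpos : 0 < c := Real.rpow_pos_of_pos (by positivity) _
  refine Real.sqrt_pos.2 (lt_of_lt_of_le
    (show 0 < 1 / 18 * (c ^ 2 / 2) * (1 / 8 : ℝ) ^ (2 * β + 3) by positivity) (le_csInf ?_ ?_))
  · exact ⟨_, 1 / 2, ⟨by norm_num, by norm_num⟩, 0,
      ⟨le_rfl, by linarith [Real.pi_gt_three]⟩, 0, 0, rfl⟩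
  rintro _ ⟨δ, ⟨hδ0, hδ1⟩, x, ⟨hx0, hx1⟩, c₁, c₂, rfl⟩
  obtain ⟨m, hm1, hm2⟩ := exists_nat_pow_near_of_lt_one (x := δ / 4) (y := (1 / 2 : ℝ))
    (by positivity) (by linarith) (by norm_num) (by norm_num)
  set d : ℝ := (1 / 2) ^ (m + 1) with hd
  have hdpos : 0 < d := by positivity
  have hd8 : 1 / 8 * δ ≤ d := by rw [hd, pow_succ]; linarith
  set k : ℕ := ⌈x / d⌉₊ with hk
  have hk1 : x ≤ k * d := (div_le_iff₀ hdpos).1 (Nat.le_ceil _)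
  have hk2 : k * d < x + d := by
    have := Nat.ceil_lt_add_one (div_nonneg hx0 hdpos.le)
    have h2 := mul_lt_mul_of_pos_right this hdpos
    rwa [add_mul, div_mul_cancel₀ _ hdpos.ne', one_mul] at h2
  have hGk := hG (m + 1) k (by omega) (by rw [← hd]; linarith)
  rw [← hd] at hGk
  have hDc : Continuous (secondDiff d (primOfI v)) := by unfold secondDiff; fun_prop
  have hlow := sq_integral_ge_of_negative_moment_le hα hDc hdpos
    (by positivity : 0 < C * d ^ (-((β - α) / (1 + α)))) hGk
  have hup := integral_secondDiff_sq_le hψ (x := x) (δ := δ) hdpos hk1 (by linarith) c₁ c₂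
  have hL : (d / (2 * (C * d ^ (-((β - α) / (1 + α)))))) ^ (1 + α) = c * d ^ (1 + β) := by
    have : d / (2 * (C * d ^ (-((β - α) / (1 + α)))))
        = 1 / (2 * C) * d ^ (1 + (β - α) / (1 + α)) := by
      rw [Real.rpow_neg hdpos.le, Real.rpow_add hdpos, Real.rpow_one]
      field_simp
    rw [this, Real.mul_rpow (by positivity) (by positivity), ← Real.rpow_mul hdpos.le]
    congr 2
    field_simp
    ring
  have hpow : d / 2 * (c * d ^ (1 + β)) ^ 2 = c ^ 2 / 2 * d ^ (2 * β + 3) := by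
    rw [show 2 * β + 3 = 1 + ((1 + β) + (1 + β)) by ring,
      Real.rpow_add hdpos 1 ((1 + β) + (1 + β)), Real.rpow_add hdpos (1 + β) (1 + β),
      Real.rpow_one]
    ring
  rw [hL, hpow] at hlow
  have hdd : (1 / 8 : ℝ) ^ (2 * β + 3) * δ ^ (2 * β + 3) ≤ d ^ (2 * β + 3) := by
    rw [← Real.mul_rpow (by norm_num) hδ0.le]
    exact Real.rpow_le_rpow (by positivity) hd8 (by linarith)
  have hI : 1 / 18 * (c ^ 2 / 2 * ((1 / 8 : ℝ) ^ (2 * β + 3) * δ ^ (2 * β + 3)))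
      ≤ ∫ y in x..(x + δ), (primOfI v y - c₁ - c₂ * y) ^ 2 := by
    have : c ^ 2 / 2 * ((1 / 8 : ℝ) ^ (2 * β + 3) * δ ^ (2 * β + 3))
        ≤ c ^ 2 / 2 * d ^ (2 * β + 3) := by gcongr
    linarith
  calc 1 / 18 * (c ^ 2 / 2) * (1 / 8 : ℝ) ^ (2 * β + 3)
      = δ ^ (-(2 * β + 3)) *
        (1 / 18 * (c ^ 2 / 2 * ((1 / 8 : ℝ) ^ (2 * β + 3) * δ ^ (2 * β + 3)))) := by
        rw [Real.rpow_neg hδ0.le]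
        have := (Real.rpow_pos_of_pos hδ0 (2 * β + 3)).ne'
        field_simp
    _ ≤ _ := by gcongr

theorem continuous_primOfI {v : ℝ → ℝ} (hv : IntegrableOn v (Set.Icc 0 π)) :
    Continuous (primOfI v) :=
  intervalIntegral.continuous_primitive
    (fun _ _ => ((integrable_indicator_iff measurableSet_Icc).2 hv).intervalIntegrable) 0

theorem measurable_primOfI {Ω : Type} [MeasurableSpace Ω] {u : ℝ → Ω → ℝ}
    (hu : Measurable fun p : ℝ × Ω => u p.1 p.2) :
    Measurable fun p : ℝ × Ω => primOfI (fun y => u y p.2) p.1 := by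
  have key : ∀ s : Set (ℝ × ℝ), MeasurableSet s →
      Measurable fun p : ℝ × Ω =>
        ∫ z in {z | (p.1, z) ∈ s}, Set.indicator (Set.Icc 0 π) (fun y => u y p.2) z := by
    intro s hs
    have h1 : Measurable fun q : (ℝ × Ω) × ℝ =>
        Set.indicator ((fun q : (ℝ × Ω) × ℝ => (q.1.1, q.2)) ⁻¹' s)
          (Set.indicator ((fun q : (ℝ × Ω) × ℝ => q.2) ⁻¹' Set.Icc 0 π)
            (fun q => u q.2 q.1.2)) q :=
      ((hu.comp (f := fun q : (ℝ × Ω) × ℝ => (q.2, q.1.2)) (by fun_prop)).indicator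
        (measurable_snd measurableSet_Icc)).indicator
        ((by fun_prop : Measurable fun q : (ℝ × Ω) × ℝ => (q.1.1, q.2)) hs)
    have h2 := (h1.stronglyMeasurable.integral_prod_right' (ν := volume)).measurable
    convert h2 using 2 with p
    rw [← integral_indicator (s := {z | (p.1, z) ∈ s}) (measurable_prodMk_left hs)]
    rfl
  have hA : MeasurableSet {q : ℝ × ℝ | 0 < q.2 ∧ q.2 ≤ q.1} :=
    (measurableSet_lt measurable_const measurable_snd).inter
      (measurableSet_le measurable_snd measurable_fst)
  have hB : MeasurableSet {q : ℝ × ℝ | q.1 < q.2 ∧ q.2 ≤ 0} :=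
    (measurableSet_lt measurable_fst measurable_snd).inter
      (measurableSet_le measurable_snd measurable_const)
  exact (key _ hA).sub (key _ hB)

theorem measurable_Gfun {Ω : Type} [MeasurableSpace Ω] {u : ℝ → Ω → ℝ}
    (hu : Measurable fun p : ℝ × Ω => u p.1 p.2) (α a d : ℝ) :
    Measurable fun ω => Gfun α (primOfI fun y => u y ω) a d := by
  have hp := measurable_primOfI hu
  have hs : ∀ s : ℝ, Measurable fun p : Ω × ℝ => primOfI (fun y => u y p.1) (p.2 + s) :=
    fun s => hp.comp (f := fun p : Ω × ℝ => (p.2 + s, p.1)) (by fun_prop)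
  have h0 : Measurable fun p : Ω × ℝ => primOfI (fun y => u y p.1) p.2 :=
    hp.comp (f := fun p : Ω × ℝ => (p.2, p.1)) (by fun_prop)
  have hD : Measurable fun p : Ω × ℝ => secondDiff d (primOfI fun y => u y p.1) p.2 :=
    ((hs _).sub ((hs _).const_mul 2)).add h0
  have hF : Measurable fun p : Ω × ℝ =>
      (ENNReal.ofReal |secondDiff d (primOfI fun y => u y p.1) p.2|) ^ (-(1 / (1 + α))) :=
    (ENNReal.measurable_ofReal.comp (continuous_abs.measurable.comp hD)).pow_const _
  exact hF.lintegral_prod_right'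

theorem measurable_expEnn (l : ℝ) : Measurable (expEnn l) :=
  Measurable.ite (measurableSet_singleton ⊤) measurable_const (by fun_prop)

theorem le_of_expEnn_le {l : ℝ} (hl : 0 < l) {ε : ℝ} (hε : 0 < ε) {x : ℝ≥0∞} {A : ℝ}
    (h : expEnn l x ≤ ENNReal.ofReal A) : x ≤ ENNReal.ofReal (A ^ ε / (ε * l)) := by
  unfold expEnn at h
  split_ifs at h with hx
  · simp at h
  have hA : Real.exp (l * x.toReal) ≤ A := (ENNReal.ofReal_le_ofReal_iff'.1 h).resolve_right
    (not_le.2 (Real.exp_pos _))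
  have hA0 : 0 < A := (Real.exp_pos _).trans_le hA
  have h1 : l * x.toReal ≤ A ^ ε / ε :=
    ((Real.le_log_iff_exp_le hA0).2 hA).trans (Real.log_le_rpow_div hA0.le hε)
  rw [← ENNReal.ofReal_toReal hx]
  apply ENNReal.ofReal_le_ofReal
  rw [le_div_iff₀ (by positivity)]
  rw [le_div_iff₀ hε] at h1
  linarith

/-- A doubly indexed family with uniformly bounded means, with at most `4 * 2 ^ n` members at level
`n`, is almost surely `O(4 ^ n)`. -/
theorem ae_exists_le_four_pow {Ω : Type} [MeasurableSpace Ω] {P : Measure Ω}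
    {F : ℕ → ℕ → Ω → ℝ≥0∞} (hF : ∀ n k, Measurable (F n k)) {κ : ℝ≥0∞} (hκ : κ ≠ ⊤)
    (hb : ∀ n k, ∫⁻ ω, F n k ω ∂P ≤ κ) :
    ∀ᵐ ω ∂P, ∃ s : ℝ, 0 < s ∧
      ∀ n k : ℕ, k < 4 * 2 ^ n → F n k ω ≤ ENNReal.ofReal (4 ^ n * s) := by
  set S : Ω → ℝ≥0∞ := fun ω =>
    ∑' n : ℕ, ∑ k ∈ Finset.range (4 * 2 ^ n), (4⁻¹ : ℝ≥0∞) ^ n * F n k ω with hS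
  have hmeas : ∀ n : ℕ, Measurable fun ω =>
      ∑ k ∈ Finset.range (4 * 2 ^ n), (4⁻¹ : ℝ≥0∞) ^ n * F n k ω := fun n =>
    Finset.measurable_fun_sum _ fun k _ => (hF n k).const_mul _
  have hfour : ∀ n : ℕ, (4⁻¹ : ℝ≥0∞) ^ n * 2 ^ n = 2⁻¹ ^ n := by
    intro n
    rw [← mul_pow]
    congr 1
    rw [show (4 : ℝ≥0∞) = 2 * 2 by norm_num,
      ENNReal.mul_inv (Or.inl two_ne_zero) (Or.inl ENNReal.ofNat_ne_top), mul_assoc,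
      ENNReal.inv_mul_cancel two_ne_zero ENNReal.ofNat_ne_top, mul_one]
  have hSint : ∫⁻ ω, S ω ∂P ≠ ⊤ := by
    have : ∫⁻ ω, S ω ∂P ≤ ∑' n : ℕ, 4 * κ * (2⁻¹ : ℝ≥0∞) ^ n := by
      rw [hS, lintegral_tsum fun n => (hmeas n).aemeasurable]
      refine ENNReal.tsum_le_tsum fun n => ?_
      rw [lintegral_finsetSum _ fun k _ => (hF n k).const_mul _]
      calc ∑ k ∈ Finset.range (4 * 2 ^ n), ∫⁻ ω, (4⁻¹ : ℝ≥0∞) ^ n * F n k ω ∂P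
          ≤ ∑ k ∈ Finset.range (4 * 2 ^ n), (4⁻¹ : ℝ≥0∞) ^ n * κ := by
            refine Finset.sum_le_sum fun k _ => ?_
            rw [lintegral_const_mul _ (hF n k)]
            gcongr
            exact hb n k
        _ = 4 * κ * ((4⁻¹ : ℝ≥0∞) ^ n * 2 ^ n) := by
            rw [Finset.sum_const, Finset.card_range, nsmul_eq_mul]
            push_cast
            ring
        _ = _ := by rw [hfour]
    refine ne_top_of_le_ne_top ?_ this
    rw [ENNReal.tsum_mul_left, ENNReal.tsum_geometric, ENNReal.one_sub_inv_two, inv_inv]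
    exact ENNReal.mul_ne_top (ENNReal.mul_ne_top ENNReal.ofNat_ne_top hκ) ENNReal.ofNat_ne_top
  filter_upwards [ae_lt_top (Measurable.tsum hmeas) hSint] with ω hω
  refine ⟨(S ω).toReal + 1, by positivity, fun n k hk => ?_⟩
  have h1 : (4⁻¹ : ℝ≥0∞) ^ n * F n k ω ≤ S ω :=
    (Finset.single_le_sum (f := fun k => (4⁻¹ : ℝ≥0∞) ^ n * F n k ω) (fun _ _ => zero_le)
      (Finset.mem_range.2 hk)).trans
      (ENNReal.le_tsum (f := fun n : ℕ =>
        ∑ k ∈ Finset.range (4 * 2 ^ n), (4⁻¹ : ℝ≥0∞) ^ n * F n k ω) n)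
  have h2 : S ω ≤ ENNReal.ofReal ((S ω).toReal + 1) :=
    (ENNReal.ofReal_toReal (ne_of_lt hω)).ge.trans (ENNReal.ofReal_le_ofReal (by linarith))
  calc F n k ω = 4 ^ n * ((4⁻¹ : ℝ≥0∞) ^ n * F n k ω) := by
        rw [← mul_assoc, ← mul_pow, ENNReal.mul_inv_cancel (by norm_num) ENNReal.ofNat_ne_top,
          one_pow, one_mul]
    _ ≤ 4 ^ n * ENNReal.ofReal ((S ω).toReal + 1) := by
        gcongr
        exact h1.trans h2
    _ = _ := by
        rw [ENNReal.ofReal_mul (by positivity), ENNReal.ofReal_pow (by norm_num),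
          ENNReal.ofReal_ofNat]

/-- Proposition 4.10: let `u` be a jointly measurable process on `[0,π]`
with a.s. integrable paths, and suppose `E[exp(λ G_α(ȳ,δ))] ≤ κ` uniformly over
`δ ∈ (0,1)`, `ȳ ∈ [0,π−δ]`, for some `λ, κ > 0`. Then `P(Γ_β(u) > 0) = 1` for every
`β > α`. -/
theorem gamma_positive_almost_surely
    {Ω : Type} [MeasurableSpace Ω] (P : Measure Ω) [IsProbabilityMeasure P]
    (α : ℝ) (hα : α ∈ Set.Ioo (0:ℝ) 1)
    (u : ℝ → Ω → ℝ) (hu_meas : Measurable fun p : ℝ × Ω => u p.1 p.2)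
    (hu_int : ∀ᵐ ω ∂P, IntegrableOn (fun y => u y ω) (Set.Icc 0 π))
    (lam κ : ℝ) (hlam : 0 < lam) (hκ : 0 < κ)
    (hbound : ∀ δ ∈ Set.Ioo (0:ℝ) 1, ∀ ybar ∈ Set.Icc (0:ℝ) (π - δ),
      (∫⁻ ω, expEnn lam (Gfun α (primOfI (fun y => u y ω)) ybar δ) ∂P)
        ≤ ENNReal.ofReal κ) :
    ∀ β : ℝ, α < β → P {ω | 0 < GammaI β fun y => u y ω} = 1 := by
  intro β hβ
  obtain ⟨hα0, -⟩ := hα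
  classical
  set F : ℕ → ℕ → Ω → ℝ≥0∞ := fun n k ω =>
    if 1 ≤ n ∧ (k : ℝ) * (1 / 2) ^ n ≤ π - (1 / 2) ^ n then
      expEnn lam (Gfun α (primOfI fun y => u y ω) (k * (1 / 2) ^ n) ((1 / 2) ^ n)) else 0 with hFdef
  have hF : ∀ n k, Measurable (F n k) := by
    intro n k
    by_cases h : 1 ≤ n ∧ (k : ℝ) * (1 / 2) ^ n ≤ π - (1 / 2) ^ n
    · simp only [hFdef, if_pos h]
      exact (measurable_expEnn lam).comp (measurable_Gfun hu_meas _ _ _)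
    · simp only [hFdef, if_neg h]
      exact measurable_const
  have hb : ∀ n k, ∫⁻ ω, F n k ω ∂P ≤ ENNReal.ofReal κ := by
    intro n k
    by_cases h : 1 ≤ n ∧ (k : ℝ) * (1 / 2) ^ n ≤ π - (1 / 2) ^ n
    · simp only [hFdef, if_pos h]
      exact hbound _ ⟨by positivity, pow_lt_one₀ (by norm_num) (by norm_num) (by omega)⟩ _
        ⟨by positivity, h.2⟩
    · simp only [hFdef, if_neg h, lintegral_zero, zero_le]
  have hae : ∀ᵐ ω ∂P, 0 < GammaI β fun y => u y ω := by
    filter_upwards [hu_int, ae_exists_le_four_pow hF ENNReal.ofReal_ne_top hb] with ω hω ⟨s, hs, hle⟩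
    set ε : ℝ := (β - α) / (1 + α) / 2 with hε
    have hεpos : 0 < ε := by
      have : 0 < β - α := sub_pos.2 hβ
      positivity
    refine GammaI_pos_of_dyadic_bound hα0 hβ (continuous_primOfI hω)
      (C := s ^ ε / (ε * lam)) (by positivity) fun n k hn hk => ?_
    have hk4 : k < 4 * 2 ^ n := by
      have h1 : (k : ℝ) * (1 / 2) ^ n < 4 := by
        have : (0 : ℝ) < (1 / 2) ^ n := by positivity
        linarith [Real.pi_lt_four]
      rw [one_div, inv_pow, ← div_eq_mul_inv, div_lt_iff₀ (by positivity)] at h1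
      exact_mod_cast h1
    have h := hle n k hk4
    simp only [hFdef, if_pos (And.intro hn hk)] at h
    refine (le_of_expEnn_le hlam hεpos h).trans_eq ?_
    congr 1
    have h4 : ((4 : ℝ) ^ n) ^ ε = ((1 / 2 : ℝ) ^ n) ^ (-((β - α) / (1 + α))) := by
      rw [show -((β - α) / (1 + α)) = (-2) * ε by rw [hε]; ring,
        Real.rpow_mul (by positivity)]
      congr 1
      rw [Real.rpow_neg (by positivity), Real.rpow_two, ← pow_mul, mul_comm n 2, pow_mul,
        ← inv_pow]
      norm_num
    rw [Real.mul_rpow (by positivity) hs.le, h4]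
    ring
  rw [measure_congr (Filter.eventuallyEq_univ.2 hae), measure_univ]
end
end
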